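/- For every positive integer k there exist constants C_k, D_k > 0 such that the following holds. Let p be a prime, G_1, …, G_k finite-dimensional F_p-vector spaces, f : G_1 × ⋯ × G_k → 𝔻 a function, ε > 0, and let μ_1, …, μ_n ∈ MLS_ε(f) be multilinear forms with n ≥ 20·ε^{−2^{k+1}}. Then there are distinct indices i, j ∈ [n] such that prank(μ_i − μ_j) ≤ C_k·(log_p ε^{−1})^{D_k}. -/

import Mathlib

noncomputable section

namespace DGU

/-- `e^{2πi t/p}` for `t ∈ ℤ/p`. -/
def chi (p : ℕ) (t : ZMod p) : ℂ :=
  Complex.exp (2 * Real.pi * Complex.I * ((t.val : ℂ) / (p : ℂ)))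

/-- Average of a complex-valued function over a finite type. -/
def cavg {α : Type*} [Fintype α] (f : α → ℂ) : ℂ :=
  (∑ x, f x) / (Fintype.card α : ℂ)

/-- Average of a real-valued function over a finite type. -/
def ravg {α : Type*} [Fintype α] (f : α → ℝ) : ℝ :=
  (∑ x, f x) / (Fintype.card α : ℝ)

/-- Multiplicative discrete derivative. -/
def mder {G : Type*} [Add G] (u : G) (f : G → ℂ) : G → ℂ :=
  fun x => f (x + u) * (starRingEnd ℂ) (f x)

/-- Iterated multiplicative discrete derivative along a list of directions. -/
def mderList {G : Type*} [Add G] (l : List G) (f : G → ℂ) : G → ℂ :=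
  l.foldr mder f

/-- Additive discrete derivative. -/
def aderiv {G R : Type*} [Add G] [Sub R] (a : G) (F : G → R) : G → R :=
  fun x => F (x + a) - F x

/-- Iterated additive discrete derivative along a list of directions. -/
def aderivList {G R : Type*} [Add G] [Sub R] (l : List G) (F : G → R) : G → R :=
  l.foldr aderiv F

/-- `t`-fold iterated exponential. -/
def iterExp : ℕ → ℝ → ℝ
  | 0, x => x
  | t + 1, x => Real.exp (iterExp t x)

/-- `P : G → R` is a polynomial of degree at most `d`. -/
def IsPolyDegLE {G R : Type*} [Add G] [Sub R] [Zero R] (d : ℕ) (P : G → R) : Prop :=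
  ∀ (a : Fin (d + 1) → G) (x : G), aderivList (List.ofFn a) P x = 0

/-- `n`-fold complex conjugation. -/
def conjIter (n : ℕ) (z : ℂ) : ℂ := (starRingEnd ℂ)^[n] z

/-- Cubical convolution of a family of functions indexed by subsets of `[k]`. -/
def cubicalConv {k : ℕ} {G : Fin k → Type*} [∀ i, AddCommGroup (G i)] [∀ i, Fintype (G i)]
    (f : Finset (Fin k) → (∀ i, G i) → ℂ) : (∀ i, G i) → ℂ :=
  fun a => cavg (fun x : ∀ i, G i =>
    ∏ I : Finset (Fin k),
      conjIter (k - I.card) (f I (fun i => if i ∈ I then x i + a i else x i)))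

/-- A map on a product of `ℤ/p`-vector spaces is multiaffine if it is affine in each
variable separately. -/
def IsMultiaffine (p : ℕ) {k : ℕ} {G : Fin k → Type*} [∀ i, AddCommGroup (G i)]
    [∀ i, Module (ZMod p) (G i)] {W : Type*} [AddCommGroup W] [Module (ZMod p) W]
    (α : (∀ i, G i) → W) : Prop :=
  ∀ (d : Fin k) (x : ∀ i, G i), ∃ (L : G d →ₗ[ZMod p] W) (c : W),
    ∀ y : G d, α (Function.update x d y) = L y + c

/-- A function `ψ : A^m × G₁ × ⋯ × G_k → ℤ/p` which is linear in each of the `m + k`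
variables separately. -/
def MultilinearPair (p m k : ℕ) (A : Type*) [AddCommGroup A] [Module (ZMod p) A]
    (G : Fin k → Type*) [∀ i, AddCommGroup (G i)] [∀ i, Module (ZMod p) (G i)]
    (ψ : (Fin m → A) → (∀ j, G j) → ZMod p) : Prop :=
  (∀ (i : Fin m) (a : Fin m → A) (d : ∀ j, G j) (u v : A) (s t : ZMod p),
      ψ (Function.update a i (s • u + t • v)) d =
        s * ψ (Function.update a i u) d + t * ψ (Function.update a i v) d) ∧
  (∀ (j : Fin k) (a : Fin m → A) (d : ∀ l, G l) (u v : G j) (s t : ZMod p),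
      ψ a (Function.update d j (s • u + t • v)) =
        s * ψ a (Function.update d j u) + t * ψ a (Function.update d j v))

/-- The `2^k`-th power of the Gowers box norm. -/
def boxPow {k : ℕ} {G : Fin k → Type*} [∀ i, Fintype (G i)] (f : (∀ i, G i) → ℂ) : ℂ :=
  cavg (fun z : (∀ i, G i) × (∀ i, G i) =>
    ∏ I : Finset (Fin k), conjIter I.card (f (fun i => if i ∈ I then z.1 i else z.2 i)))

/-- `μ` belongs to the `ε`-large multilinear spectrum of `f`. -/
def MemMLS (p : ℕ) {k : ℕ} {G : Fin k → Type*} [∀ i, Fintype (G i)] [∀ i, AddCommGroup (G i)]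
    [∀ i, Module (ZMod p) (G i)] (ε : ℝ) (f : (∀ i, G i) → ℂ)
    (μ : MultilinearMap (ZMod p) G (ZMod p)) : Prop :=
  ε ^ 2 ^ k ≤ (boxPow (fun x => f x * chi p (μ x))).re


/-- `α` admits a partition-rank decomposition with `m` terms. -/
def HasPrankDecomp (p : ℕ) {k : ℕ} (G : Fin k → Type*) [∀ i, AddCommGroup (G i)]
    [∀ i, Module (ZMod p) (G i)]
    (α : MultilinearMap (ZMod p) G (ZMod p)) (m : ℕ) : Prop :=
  ∃ (I : Fin m → Finset (Fin k))
    (β : ∀ i : Fin m, MultilinearMap (ZMod p) (fun j : {j : Fin k // j ∈ I i} => G j.1)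
      (ZMod p))
    (γ : ∀ i : Fin m, MultilinearMap (ZMod p) (fun j : {j : Fin k // j ∉ I i} => G j.1)
      (ZMod p)),
    (∀ i, (I i).Nonempty ∧ I i ≠ Finset.univ) ∧
    ∀ x : ∀ j, G j, α x = ∑ i : Fin m, β i (fun j => x j.1) * γ i (fun j => x j.1)

open MvPolynomial in
theorem totalDegree_pderiv_le_totalDegree {K σ : Type*} [CommRing K] (i : σ)
    (p : MvPolynomial σ K) : (pderiv i p).totalDegree ≤ p.totalDegree := by
  classical
  conv_lhs => rw [p.as_sum]
  rw [map_sum]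
  refine totalDegree_finsetSum_le fun s hs => ?_
  rw [pderiv_monomial]
  refine (totalDegree_monomial_le _ _).trans (le_trans ?_ (le_totalDegree hs))
  exact Finsupp.degree_mono tsub_le_self

open MvPolynomial in
theorem totalDegree_det_le {K σ n : Type*} [CommRing K] [Fintype n] [DecidableEq n]
    (M : Matrix n n (MvPolynomial σ K)) {d : ℕ} (hM : ∀ i j, (M i j).totalDegree ≤ d) :
    M.det.totalDegree ≤ Fintype.card n * d := by
  rw [Matrix.det_apply]
  refine totalDegree_finsetSum_le fun τ _ => ?_
  refine (totalDegree_smul_le _ _).trans ((totalDegree_finsetProd _ _).trans ?_)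
  exact (Finset.sum_le_card_nsmul _ _ d fun i _ => hM _ _).trans (by simp)

open MvPolynomial in
theorem totalDegree_adjugate_le {K σ n : Type*} [CommRing K] [Fintype n] [DecidableEq n]
    (M : Matrix n n (MvPolynomial σ K)) {d : ℕ} (hM : ∀ i j, (M i j).totalDegree ≤ d) (i j : n) :
    (M.adjugate i j).totalDegree ≤ Fintype.card n * d := by
  rw [Matrix.adjugate_apply]
  refine totalDegree_det_le _ fun a b => ?_
  rw [Matrix.updateRow_apply]
  split_ifs
  · rw [Pi.single_apply]; split_ifs <;> simp
  · exact hM _ _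

open MvPolynomial in
theorem totalDegree_mul_apply_le {K σ l m n : Type*} [CommRing K] [Fintype m]
    (M : Matrix l m (MvPolynomial σ K)) (N : Matrix m n (MvPolynomial σ K)) {a b : ℕ}
    (hM : ∀ i j, (M i j).totalDegree ≤ a) (hN : ∀ i j, (N i j).totalDegree ≤ b) (i : l) (j : n) :
    ((M * N) i j).totalDegree ≤ a + b := by
  rw [Matrix.mul_apply]
  exact totalDegree_finsetSum_le fun x _ =>
    (totalDegree_mul _ _).trans (add_le_add (hM _ _) (hN _ _))

/-- First-order Taylor expansion, modulo an ideal containing all products of increments. -/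
theorem aeval_add_sub_mem {K σ B : Type*} [CommRing K] [Fintype σ] [CommRing B] [Algebra K B]
    (J : Ideal B) (u v : σ → B) (hv : ∀ s t, v s * v t ∈ J) (p : MvPolynomial σ K) :
    MvPolynomial.aeval (fun s => u s + v s) p -
      (MvPolynomial.aeval u p + ∑ s, MvPolynomial.aeval u (MvPolynomial.pderiv s p) * v s) ∈ J := by
  classical
  induction p using MvPolynomial.induction_on with
  | C a => simp
  | add p q hp hq =>
    have := J.add_mem hp hq
    convert this using 1
    simp only [map_add, add_mul, Finset.sum_add_distrib]
    ring
  | mul_X p n hp =>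
    have h1 := J.mul_mem_right (u n + v n) hp
    have h2 : ∑ s, MvPolynomial.aeval u (MvPolynomial.pderiv s p) * (v s * v n) ∈ J :=
      J.sum_mem fun s _ => J.mul_mem_left _ (hv _ _)
    convert J.add_mem h1 h2 using 1
    simp only [map_mul, MvPolynomial.aeval_X, Derivation.leibniz, MvPolynomial.pderiv_X, smul_eq_mul,
      map_add, add_mul, Finset.sum_add_distrib]
    have h3 : ∑ x, MvPolynomial.aeval u p * MvPolynomial.aeval u
        (Pi.single (M := fun _ => MvPolynomial σ K) x 1 n) * v x
        = MvPolynomial.aeval u p * v n := by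
      rw [Finset.sum_eq_single n]
      · simp
      · intro b _ hb; simp [hb.symm]
      · simp
    simp only [Finset.sum_mul, sub_mul, add_mul, mul_add] at *
    have h4 : ∀ x, u n * MvPolynomial.aeval u (MvPolynomial.pderiv x p) * v x =
       MvPolynomial.aeval u (MvPolynomial.pderiv x p) * v x * u n := fun x => by ring
    rw [h3]
    simp only [h4, mul_assoc]
    ring

/-- A matrix of rank at least `r` compresses to an invertible `r × r` matrix. -/
theorem exists_mul_mul_eq_one {K ι σ : Type*} [Field K] [Fintype ι] [Fintype σ] [DecidableEq σ]
    [DecidableEq ι]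
    (A : Matrix ι σ K) {r : ℕ} (hr : r ≤ A.rank) :
    ∃ (U : Matrix (Fin r) ι K) (W : Matrix σ (Fin r) K), U * A * W = 1 := by
  obtain ⟨f, hf⟩ := exists_linearIndependent_of_le_finrank (R := K)
    (M := LinearMap.range A.mulVecLin) (n := r) hr
  choose w hw using fun i => (f i).2
  have hli : LinearIndependent K (fun i => A.mulVec (w i)) := by
    have := hf.map' (Submodule.subtype _) (Submodule.ker_subtype _)
    rwa [show ⇑(Submodule.subtype _) ∘ f = fun i => A.mulVec (w i) from
      funext fun i => (hw i).symm] at this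
  let W : Matrix σ (Fin r) K := Matrix.of fun s i => w i s
  have hAW : Function.Injective (A * W).mulVec := by
    rw [Matrix.mulVec_injective_iff]
    rwa [show (A * W).col = fun i => A.mulVec (w i) from rfl]
  have hk : LinearMap.ker (A * W).mulVecLin = ⊥ := by
    rw [LinearMap.ker_eq_bot]; exact hAW
  obtain ⟨g, hg⟩ := (A * W).mulVecLin.exists_leftInverse_of_injective hk
  refine ⟨LinearMap.toMatrix' g, W, ?_⟩
  rw [Matrix.mul_assoc]
  have : LinearMap.toMatrix' (g ∘ₗ (A * W).mulVecLin) = 1 := by rw [hg]; simp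
  rw [LinearMap.toMatrix'_comp] at this
  rw [← this]
  congr 1
  exact (LinearMap.toMatrix'_toLin' (A*W)).symm

/-- If an `r × r` compression of a rank `r` matrix is invertible, the Schur complement vanishes. -/
theorem schur_eq_zero {K ι σ : Type*} [Field K] [Fintype ι] [Fintype σ] [DecidableEq σ]
    [DecidableEq ι]
    (A : Matrix ι σ K) {r : ℕ} (hr : A.rank = r) (U : Matrix (Fin r) ι K)
    (W : Matrix σ (Fin r) K) (h : (U * A * W).det ≠ 0) :
    (U * A * W).det • A - A * W * (U * A * W).adjugate * (U * A) = 0 := by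
  set P := U * A * W with hP
  have hu : IsUnit P.det := isUnit_iff_ne_zero.mpr h
  let V := LinearMap.range A.mulVecLin
  let φ : V →ₗ[K] (Fin r → K) := U.mulVecLin ∘ₗ V.subtype
  have hfr : Module.finrank K V = Module.finrank K (Fin r → K) := by
    rw [Module.finrank_fin_fun]; exact hr
  have hs : Function.Surjective φ := by
    intro y
    refine ⟨⟨A.mulVec (W.mulVec (P⁻¹.mulVec y)), ⟨W.mulVec (P⁻¹.mulVec y), rfl⟩⟩, ?_⟩
    change U.mulVec (A.mulVec (W.mulVec (P⁻¹.mulVec y))) = y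
    simp only [Matrix.mulVec_mulVec]
    rw [← Matrix.mul_assoc, ← Matrix.mul_assoc, ← hP, Matrix.mul_nonsing_inv _ hu, Matrix.one_mulVec]
  have hi : Function.Injective φ :=
    (LinearMap.injective_iff_surjective_of_finrank_eq_finrank hfr).mpr hs
  have hUM : U * (P.det • A - A * W * P.adjugate * (U * A)) = 0 := by
    rw [Matrix.mul_sub, Matrix.mul_smul]
    have : U * (A * W * P.adjugate * (U * A)) = P * P.adjugate * (U * A) := by
      rw [hP]; simp only [Matrix.mul_assoc]
    rw [this, Matrix.mul_adjugate]
    simp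
  have hfac : P.det • A - A * W * P.adjugate * (U * A) =
      A * (P.det • (1 : Matrix σ σ K) - W * P.adjugate * (U * A)) := by
    rw [Matrix.mul_sub]; simp [Matrix.mul_assoc]
  rw [hfac] at hUM ⊢
  set Q := P.det • (1 : Matrix σ σ K) - W * P.adjugate * (U * A)
  ext i s
  set y := Q.mulVec (Pi.single s 1)
  have hz : φ ⟨A.mulVec y, ⟨y, rfl⟩⟩ = φ 0 := by
    rw [map_zero]
    change U.mulVec (A.mulVec (Q.mulVec _)) = 0
    rw [Matrix.mulVec_mulVec, Matrix.mulVec_mulVec, Matrix.mul_assoc, hUM, Matrix.zero_mulVec]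
  have := congrArg Subtype.val (hi hz)
  change A.mulVec (Q.mulVec _) = 0 at this
  rw [Matrix.mulVec_mulVec, Matrix.mulVec_single_one] at this
  exact congrFun this i

theorem card_zeros_mul_card_le {K τ : Type*} [Field K] [Fintype K] [DecidableEq K] [Fintype τ]
    (p : MvPolynomial τ K) (hp : p ≠ 0) :
    Nat.card {x : τ → K // MvPolynomial.eval x p = 0} * Fintype.card K ≤
      p.totalDegree * Fintype.card K ^ Fintype.card τ := by
  classical
  let e := Fintype.equivFin τ
  have hinj : Function.Injective (MvPolynomial.rename (R := K) e) :=
    MvPolynomial.rename_injective _ e.injective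
  have hp' : MvPolynomial.rename e p ≠ 0 := by
    rw [Ne, map_eq_zero_iff _ hinj]; exact hp
  have h := MvPolynomial.schwartz_zippel_totalDegree hp' (Finset.univ : Finset K)
  have hd : (MvPolynomial.rename e p).totalDegree ≤ p.totalDegree :=
    MvPolynomial.totalDegree_rename_le _ _
  have hcard : Nat.card {x : τ → K // MvPolynomial.eval x p = 0} =
      ({f ∈ Fintype.piFinset fun _ => (Finset.univ : Finset K) |
        MvPolynomial.eval f (MvPolynomial.rename e p) = 0} : Finset (Fin _ → K)).card := by
    rw [Nat.card_eq_fintype_card, ← Fintype.card_coe]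
    refine Fintype.card_congr ((Equiv.arrowCongr e (Equiv.refl K)).subtypeEquiv fun x => ?_)
    simp only [Fintype.piFinset_univ, Finset.mem_filter, Finset.mem_univ, true_and,
      MvPolynomial.eval_rename]
    have : (Equiv.arrowCongr e (Equiv.refl K) x ∘ e) = x := by
      funext t; simp
    rw [this]
  rw [← hcard] at h
  have hq : 0 < Fintype.card K := Fintype.card_pos
  have hq' : (0 : ℚ≥0) < Fintype.card K := by exact_mod_cast hq
  rw [Finset.card_univ, div_le_div_iff₀ (by positivity) hq'] at h
  have h2 : Nat.card {x : τ → K // MvPolynomial.eval x p = 0} * Fintype.card K ≤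
      (MvPolynomial.rename e p).totalDegree * Fintype.card K ^ Fintype.card τ := by
    exact_mod_cast h
  exact h2.trans (Nat.mul_le_mul_right _ hd)

theorem card_det_eq_zero_le {K ι σ : Type*} [Field K] [Fintype K] [DecidableEq K] [Fintype ι]
    [Fintype σ] [DecidableEq σ] [DecidableEq ι]
    (A : Matrix ι σ K) {r : ℕ} (hr : r ≤ A.rank) (hq : 4 * r ≤ Fintype.card K) :
    2 * Nat.card {x : Matrix (Fin r) ι K × Matrix σ (Fin r) K // (x.1 * A * x.2).det = 0} ≤
      Fintype.card (Matrix (Fin r) ι K × Matrix σ (Fin r) K) := by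
  classical
  let τ := (Fin r × ι) ⊕ (σ × Fin r)
  let UU : Matrix (Fin r) ι (MvPolynomial τ K) :=
    Matrix.of fun i j => MvPolynomial.X (Sum.inl (i, j))
  let WW : Matrix σ (Fin r) (MvPolynomial τ K) :=
    Matrix.of fun i j => MvPolynomial.X (Sum.inr (i, j))
  let AA : Matrix ι σ (MvPolynomial τ K) := A.map MvPolynomial.C
  let P : MvPolynomial τ K := (UU * AA * WW).det
  let e : (τ → K) ≃ Matrix (Fin r) ι K × Matrix σ (Fin r) K :=
    (Equiv.sumArrowEquivProdArrow _ _ _).trans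
      (Equiv.prodCongr (Equiv.curry _ _ _) (Equiv.curry _ _ _))
  have heval : ∀ x : τ → K, MvPolynomial.eval x P = ((e x).1 * A * (e x).2).det := by
    intro x
    have h1 : UU.map (MvPolynomial.eval x) = (e x).1 := by
      ext i j; simp [UU, e]; rfl
    have h2 : WW.map (MvPolynomial.eval x) = (e x).2 := by
      ext i j; simp [WW, e]; rfl
    have h3 : AA.map (MvPolynomial.eval x) = A := by
      ext i j; simp [AA]
    rw [RingHom.map_det, RingHom.mapMatrix_apply, Matrix.map_mul, Matrix.map_mul, h1, h2, h3]
  have hP : P ≠ 0 := by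
    intro h0
    obtain ⟨U, W, hUW⟩ := exists_mul_mul_eq_one A hr
    have := heval (e.symm (U, W))
    rw [h0, e.apply_symm_apply, hUW] at this
    simp at this
  have hdeg : P.totalDegree ≤ r * 2 := by
    refine (totalDegree_det_le (d := 1 + 0 + 1) _ fun i j => ?_).trans (by simp)
    refine totalDegree_mul_apply_le _ _ (fun i j => totalDegree_mul_apply_le _ _ ?_ ?_ i j) ?_ i j
    · intro i j; simp [UU, MvPolynomial.totalDegree_X]
    · intro i j; simp [AA]
    · intro i j; simp [WW, MvPolynomial.totalDegree_X]
  have h := card_zeros_mul_card_le P hP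
  have hc : Nat.card {x : τ → K // MvPolynomial.eval x P = 0} =
      Nat.card {x : Matrix (Fin r) ι K × Matrix σ (Fin r) K // (x.1 * A * x.2).det = 0} :=
    Nat.card_congr (e.subtypeEquiv fun x => by rw [heval])
  rw [hc, ← Fintype.card_fun, Fintype.card_congr e] at h
  have hq0 : 0 < Fintype.card K := Fintype.card_pos
  set N := Nat.card {x : Matrix (Fin r) ι K × Matrix σ (Fin r) K // (x.1 * A * x.2).det = 0}
  set M := Fintype.card (Matrix (Fin r) ι K × Matrix σ (Fin r) K)
  have h4 : 2 * N * Fintype.card K ≤ M * Fintype.card K := by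
    calc 2 * N * Fintype.card K = 2 * (N * Fintype.card K) := by ring
      _ ≤ 2 * (r * 2 * M) :=
        Nat.mul_le_mul_left _ (h.trans (Nat.mul_le_mul_right _ hdeg))
      _ = M * (4 * r) := by ring
      _ ≤ _ := by gcongr
  exact Nat.le_of_mul_le_mul_right h4 hq0

/-- A common compression which is invertible for at least half of a family of matrices. -/
theorem exists_common_compression {K ι σ Ω : Type*} [Field K] [Fintype K] [DecidableEq K]
    [Fintype ι] [Fintype σ] [DecidableEq σ] [DecidableEq ι]
    (Y : Finset Ω) (A : Ω → Matrix ι σ K) {r : ℕ} (hr : ∀ z ∈ Y, r ≤ (A z).rank)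
    (hq : 4 * r ≤ Fintype.card K) :
    ∃ (U : Matrix (Fin r) ι K) (W : Matrix σ (Fin r) K),
      Y.card ≤ 2 * {z ∈ Y | (U * A z * W).det ≠ 0}.card := by
  classical
  by_contra! hcon
  let T := Matrix (Fin r) ι K × Matrix σ (Fin r) K
  have h1 : ∀ x : T, Y.card < 2 * {z ∈ Y | (x.1 * A z * x.2).det = 0}.card := by
    intro x
    have := hcon x.1 x.2
    have h2 := Finset.card_filter_add_card_filter_not (s := Y) (fun z => (x.1 * A z * x.2).det = 0)
    simp only [ne_eq] at this
    omega
  have h2 : ∑ x : T, {z ∈ Y | (x.1 * A z * x.2).det = 0}.card =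
      ∑ z ∈ Y, Nat.card {x : T // (x.1 * A z * x.2).det = 0} := by
    simp only [Finset.card_filter]
    rw [Finset.sum_comm]
    refine Finset.sum_congr rfl fun z _ => ?_
    rw [Nat.card_eq_fintype_card, Fintype.card_subtype, Finset.card_filter]
  have h3 : ∑ z ∈ Y, 2 * Nat.card {x : T // (x.1 * A z * x.2).det = 0} ≤ Y.card * Fintype.card T := by
    rw [← smul_eq_mul, ← Finset.sum_const]
    exact Finset.sum_le_sum fun z hz => card_det_eq_zero_le (A z) (hr z hz) hq
  have h4 : ∑ _x : T, Y.card < ∑ x : T, 2 * {z ∈ Y | (x.1 * A z * x.2).det = 0}.card :=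
    Finset.sum_lt_sum_of_nonempty Finset.univ_nonempty fun x _ => h1 x
  rw [← Finset.mul_sum] at h3 h4
  rw [h2] at h4
  simp only [Finset.sum_const, smul_eq_mul, Finset.card_univ] at h4
  rw [mul_comm] at h4
  omega

theorem exists_separating_polynomial {K σ : Type*} [Field K] (Z : Finset (σ → K)) (z : σ → K) :
    ∃ c : MvPolynomial σ K, c.totalDegree ≤ Z.card ∧ MvPolynomial.eval z c = 1 ∧
      ∀ w ∈ Z, w ≠ z → MvPolynomial.eval w c = 0 := by
  classical
  have h : ∀ w : σ → K, ∃ g : MvPolynomial σ K, g.totalDegree ≤ 1 ∧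
      (w ≠ z → MvPolynomial.eval z g = 1 ∧ MvPolynomial.eval w g = 0) := by
    intro w
    by_cases hw : w = z
    · exact ⟨0, by simp, fun h => absurd hw h⟩
    obtain ⟨i, hi⟩ := Function.ne_iff.mp hw
    refine ⟨MvPolynomial.C (z i - w i)⁻¹ * (MvPolynomial.X i - MvPolynomial.C (w i)), ?_, fun _ => ?_⟩
    · refine (MvPolynomial.totalDegree_mul _ _).trans ?_
      rw [MvPolynomial.totalDegree_C, zero_add]
      refine (MvPolynomial.totalDegree_sub _ _).trans ?_
      simp [MvPolynomial.totalDegree_X]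
    · have : z i - w i ≠ 0 := sub_ne_zero.mpr (Ne.symm hi)
      simp [this]
  choose g hg1 hg2 using h
  refine ⟨∏ w ∈ Z.erase z, g w, ?_, ?_, ?_⟩
  · refine (MvPolynomial.totalDegree_finsetProd _ _).trans ?_
    refine (Finset.sum_le_card_nsmul _ _ 1 fun w _ => hg1 w).trans ?_
    simpa using Finset.card_le_card (Finset.erase_subset z Z)
  · rw [map_prod]
    exact Finset.prod_eq_one fun w hw => (hg2 w (Finset.ne_of_mem_erase hw)).1
  · intro w hw hwz
    rw [map_prod]
    exact Finset.prod_eq_zero (Finset.mem_erase.mpr ⟨hwz, hw⟩) (hg2 w hwz).2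

/-- A substitution in which `G` has prescribed linear part at a nonsingular zero `z`. -/
theorem exists_local_substitution {K : Type*} [Field K] {R : ℕ}
    (G : Fin R → MvPolynomial (Fin R) K) (z : Fin R → K)
    (hz : ∀ l, MvPolynomial.eval z (G l) = 0)
    (hJ : (Matrix.of fun l i => MvPolynomial.eval z (MvPolynomial.pderiv i (G l))).det ≠ 0) :
    ∃ Θ : MvPolynomial (Fin R) K →ₐ[K] Polynomial (MvPolynomial (Fin R) K),
      (∀ p, (Θ p).coeff 0 = MvPolynomial.C (MvPolynomial.eval z p)) ∧
      ∀ l, ∃ q, Θ (G l) = Polynomial.X * (Polynomial.C (MvPolynomial.X l) + Polynomial.X * q) := by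
  classical
  set J : Matrix (Fin R) (Fin R) K :=
    Matrix.of fun l i => MvPolynomial.eval z (MvPolynomial.pderiv i (G l)) with hJdef
  let S := MvPolynomial (Fin R) K
  let ℓ : Fin R → S := fun i => ∑ j, MvPolynomial.C (J⁻¹ i j) * MvPolynomial.X j
  let u : Fin R → Polynomial S := fun i => algebraMap K _ (z i)
  let v : Fin R → Polynomial S := fun i => Polynomial.X * Polynomial.C (ℓ i)
  have hℓ : ∀ l, ∑ i, MvPolynomial.C (J l i) * ℓ i = MvPolynomial.X l := by
    intro l
    simp only [ℓ, Finset.mul_sum, ← mul_assoc, ← map_mul]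
    rw [Finset.sum_comm]
    simp only [← Finset.sum_mul, ← map_sum]
    have : ∀ j, ∑ i, J l i * J⁻¹ i j = (1 : Matrix (Fin R) (Fin R) K) l j := by
      intro j
      rw [← Matrix.mul_nonsing_inv J (isUnit_iff_ne_zero.mpr hJ), Matrix.mul_apply]
    simp only [this]
    rw [Finset.sum_eq_single l]
    · simp
    · intro b _ hb; simp [hb.symm]
    · simp
  have hu : ∀ p : S, MvPolynomial.aeval u p = algebraMap K _ (MvPolynomial.eval z p) := by
    intro p
    have := MvPolynomial.aeval_algebraMap_apply (Polynomial S) z p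
    rw [MvPolynomial.aeval_eq_eval] at this
    exact this
  refine ⟨MvPolynomial.aeval fun i => u i + v i, ?_, ?_⟩
  · intro p
    have := congrArg (fun φ : S →ₐ[K] S => φ p) (MvPolynomial.algHom_ext
      (f := ((Polynomial.aeval (R := S) (0 : S)).restrictScalars K).comp
        (MvPolynomial.aeval fun i => u i + v i))
      (g := (Algebra.ofId K S).comp (MvPolynomial.aeval z)) (fun i => by
        simp [u, v, Algebra.ofId_apply, IsScalarTower.algebraMap_apply K S (Polynomial S)]))
    simp only [AlgHom.comp_apply, Algebra.ofId_apply,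
      AlgHom.restrictScalars_apply] at this
    rw [Polynomial.coeff_zero_eq_aeval_zero]
    exact this
  · intro l
    have h := aeval_add_sub_mem (Ideal.span {(Polynomial.X ^ 2 : Polynomial S)}) u v (fun s t => by
      rw [Ideal.mem_span_singleton]
      exact ⟨Polynomial.C (ℓ s) * Polynomial.C (ℓ t), by simp only [v]; ring⟩) (G l)
    rw [Ideal.mem_span_singleton] at h
    obtain ⟨q, hq⟩ := h
    refine ⟨q, ?_⟩
    rw [sub_eq_iff_eq_add] at hq
    rw [hq, hu, hz, map_zero, zero_add]
    have : ∑ s, MvPolynomial.aeval u (MvPolynomial.pderiv s (G l)) * v s =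
        Polynomial.X * Polynomial.C (MvPolynomial.X l) := by
      rw [← hℓ l, map_sum, Finset.mul_sum]
      refine Finset.sum_congr rfl fun s _ => ?_
      rw [hu]
      simp only [v, J, Matrix.of_apply, map_mul]
      change Polynomial.C (MvPolynomial.C _) * _ = _
      ring
    rw [this]; ring

open Classical in
/-- Products of separating polynomials with monomials in `G` are linearly independent. -/
theorem separating_mul_pow_independent {K : Type*} [Field K] {R N : ℕ}
    (G : Fin R → MvPolynomial (Fin R) K) (Z : Finset (Fin R → K))
    (hz : ∀ z ∈ Z, ∀ l, MvPolynomial.eval z (G l) = 0)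
    (hJ : ∀ z ∈ Z, (Matrix.of fun l i => MvPolynomial.eval z (MvPolynomial.pderiv i (G l))).det ≠ 0)
    (c : Z → MvPolynomial (Fin R) K)
    (hc : ∀ z w : Z, MvPolynomial.eval z.1 (c w) = if w = z then 1 else 0)
    (a : Z × (Fin R → Fin N) → K)
    (ha : ∑ x, MvPolynomial.C (a x) * (c x.1 * ∏ l, G l ^ (x.2 l : ℕ)) = 0) : a = 0 := by
  by_contra hne
  obtain ⟨x, hx, hmin⟩ := Finset.exists_min_image
    ({x | a x ≠ 0} : Finset (Z × (Fin R → Fin N))) (fun x => ∑ l, (x.2 l : ℕ)) (by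
      obtain ⟨x, hx⟩ := Function.ne_iff.mp hne
      exact ⟨x, by simpa using hx⟩)
  simp only [Finset.mem_filter, Finset.mem_univ, true_and] at hx hmin
  obtain ⟨z, e⟩ := x
  set E := ∑ l, (e l : ℕ) with hE
  obtain ⟨Θ, hΘ, hG⟩ := exists_local_substitution G z.1 (hz z.1 z.2) (hJ z.1 z.2)
  choose q hq using hG
  have h1 := congrArg (fun p => (Θ p).coeff E) ha
  simp only [map_sum, map_mul, map_prod, map_pow, hq, map_zero, Polynomial.coeff_zero,
    Polynomial.finsetSum_coeff] at h1
  have h2 : ∀ y : Z × (Fin R → Fin N), (Θ (MvPolynomial.C (a y)) * (Θ (c y.1) *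
      ∏ l, (Polynomial.X * (Polynomial.C (MvPolynomial.X l) + Polynomial.X * q l)) ^ (y.2 l : ℕ))).coeff E
      = if y.1 = z ∧ ∑ l, (y.2 l : ℕ) = E then
        MvPolynomial.monomial (Finsupp.equivFunOnFinite.symm fun l => (y.2 l : ℕ)) (a y) else 0 := by
    intro y
    have hC : Θ (MvPolynomial.C (a y)) = Polynomial.C (MvPolynomial.C (a y)) := by
      rw [← MvPolynomial.algebraMap_eq, AlgHom.commutes]
      rfl
    rw [hC]
    by_cases ha0 : a y = 0
    · simp [ha0]
    have hle := hmin y ha0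
    simp only [mul_pow, Finset.prod_mul_distrib, Finset.prod_pow_eq_pow_sum]
    have hcomm : ∀ P Q T : Polynomial (MvPolynomial (Fin R) K),
      P * (Q * (Polynomial.X ^ (∑ l, (y.2 l : ℕ)) * T)) =
        (P * Q * T) * Polynomial.X ^ (∑ l, (y.2 l : ℕ)) := fun P Q T => by ring
    rw [hcomm, Polynomial.coeff_mul_X_pow']
    rcases hle.lt_or_eq with hlt | heq
    · rw [if_neg (by omega), if_neg (by simp; intro _; omega)]
    · rw [if_pos (by omega), heq, Nat.sub_self]
      simp only [Polynomial.mul_coeff_zero, Polynomial.coeff_C_zero, hΘ, hc]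
      rw [Polynomial.coeff_zero_prod]
      simp only [Polynomial.coeff_zero_eq_eval_zero, Polynomial.eval_pow, Polynomial.eval_add,
        Polynomial.eval_C, Polynomial.eval_mul, Polynomial.eval_X, zero_mul, add_zero]
      by_cases hyz : y.1 = z
      · simp only [hyz, if_true, map_one, mul_one, and_self]
        rw [MvPolynomial.monomial_eq, Finsupp.prod_fintype _ _ (by simp)]
        simp
      · simp [hyz]
  rw [Finset.sum_congr rfl fun y _ => h2 y] at h1
  have h3 := congrArg (MvPolynomial.coeff (Finsupp.equivFunOnFinite.symm fun l => (e l : ℕ))) h1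
  rw [MvPolynomial.coeff_sum, Finset.sum_eq_single (z, e)] at h3
  · rw [if_pos ⟨rfl, rfl⟩] at h3
    simp at h3
    exact hx h3
  · rintro ⟨y, e'⟩ _ hy
    split_ifs with hcond
    · rw [MvPolynomial.coeff_monomial, if_neg]
      intro heq
      apply hy
      have : e' = e := by
        funext l
        have := congrFun (Finsupp.equivFunOnFinite.symm.injective heq) l
        exact Fin.ext this
      simp only at hcond
      rw [hcond.1, this]
    · simp
  · simp

/-- A weak Bézout bound for the number of nonsingular common zeros. -/
theorem card_nonsingular_zeros_le {K : Type*} [Field K] {R d : ℕ}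
    (G : Fin R → MvPolynomial (Fin R) K) (hd : ∀ l, (G l).totalDegree ≤ d) (Z : Finset (Fin R → K))
    (hz : ∀ z ∈ Z, ∀ l, MvPolynomial.eval z (G l) = 0)
    (hJ : ∀ z ∈ Z, (Matrix.of fun l i => MvPolynomial.eval z (MvPolynomial.pderiv i (G l))).det ≠ 0) :
    Z.card ≤ (d * R + 2) ^ R := by
  classical
  rcases Nat.eq_zero_or_pos Z.card with h0 | hN
  · simp [h0]
  set N := Z.card with hNdef
  choose c hc1 hc2 hc3 using fun z : Z => exists_separating_polynomial Z z.1
  set D := N + d * R * N with hD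
  have hdeg : ∀ x : Z × (Fin R → Fin N), (c x.1 * ∏ l, G l ^ (x.2 l : ℕ)).totalDegree ≤ D := by
    intro x
    refine (MvPolynomial.totalDegree_mul _ _).trans (add_le_add (hc1 _) ?_)
    refine (MvPolynomial.totalDegree_finsetProd _ _).trans ?_
    refine (Finset.sum_le_card_nsmul _ _ (N * d) fun l _ => ?_).trans
      (by simp only [Finset.card_univ, Fintype.card_fin, smul_eq_mul]; exact le_of_eq (by ring))
    exact (MvPolynomial.totalDegree_pow _ _).trans (Nat.mul_le_mul (x.2 l).2.le (hd l))
  let v : Z × (Fin R → Fin N) → ((Fin R → Fin (D + 1)) → K) := fun x m =>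
    MvPolynomial.coeff (Finsupp.equivFunOnFinite.symm fun l => (m l : ℕ))
      (c x.1 * ∏ l, G l ^ (x.2 l : ℕ))
  have hli : LinearIndependent K v := by
    rw [Fintype.linearIndependent_iff]
    intro a ha
    have := separating_mul_pow_independent G Z hz hJ c (fun z w => by
      split_ifs with h
      · rw [h]; exact hc2 z
      · exact hc3 w z z.2 fun h' => h (Subtype.ext h'.symm)) a (by
      ext m
      rw [MvPolynomial.coeff_zero, MvPolynomial.coeff_sum]
      simp only [MvPolynomial.coeff_C_mul]
      by_cases hm : ∀ l, m l < D + 1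
      · have h := congrFun ha fun l => ⟨m l, hm l⟩
        simp only [Finset.sum_apply, Pi.smul_apply, smul_eq_mul, Pi.zero_apply, v] at h
        rw [← h]
        have hm' : m = Finsupp.equivFunOnFinite.symm fun l => m l := by ext; simp
        conv_lhs => rw [hm']
      · push Not at hm
        obtain ⟨l, hl⟩ := hm
        refine Finset.sum_eq_zero fun x _ => ?_
        rw [MvPolynomial.coeff_eq_zero_of_totalDegree_lt, mul_zero]
        refine lt_of_lt_of_le (Nat.lt_succ_of_le (hdeg x)) (hl.trans ?_)
        by_cases hs : l ∈ m.support
        · exact Finset.single_le_sum (f := fun i => m i) (fun _ _ => Nat.zero_le _) hs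
        · rw [Finsupp.notMem_support_iff.mp hs]; exact Nat.zero_le _)
    exact fun i => congrFun this i
  have hcard := hli.fintype_card_le_finrank
  simp only [Fintype.card_prod, Fintype.card_coe, Fintype.card_fun, Fintype.card_fin,
    Module.finrank_fintype_fun_eq_card, ← hNdef] at hcard
  have h5 : (D + 1) ^ R ≤ (N * (d * R + 2)) ^ R := by
    apply Nat.pow_le_pow_left
    rw [hD]
    nlinarith
  rw [mul_pow] at h5
  have h6 : N ^ R * N ≤ N ^ R * (d * R + 2) ^ R := by
    rw [mul_comm]; exact hcard.trans h5
  exact Nat.le_of_mul_le_mul_left h6 (by positivity)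

theorem totalDegree_aeval_le {K σ τ : Type*} [CommRing K] (g : σ → MvPolynomial τ K)
    (hg : ∀ s, (g s).totalDegree ≤ 1) (p : MvPolynomial σ K) :
    (MvPolynomial.aeval g p).totalDegree ≤ p.totalDegree := by
  rw [MvPolynomial.aeval_def, MvPolynomial.eval₂_eq]
  refine MvPolynomial.totalDegree_finsetSum_le fun m hm => ?_
  refine (MvPolynomial.totalDegree_mul _ _).trans ?_
  rw [MvPolynomial.algebraMap_eq, MvPolynomial.totalDegree_C, zero_add]
  refine (MvPolynomial.totalDegree_finsetProd _ _).trans ?_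
  refine le_trans (Finset.sum_le_sum fun s _ => ?_) (MvPolynomial.le_totalDegree hm)
  exact (MvPolynomial.totalDegree_pow _ _).trans (by simpa using Nat.mul_le_mul_left (m s) (hg s))

theorem pderiv_aeval {K σ τ : Type*} [CommRing K] [Fintype σ] (g : σ → MvPolynomial τ K) (j : τ)
    (p : MvPolynomial σ K) :
    MvPolynomial.pderiv j (MvPolynomial.aeval g p) =
      ∑ s, MvPolynomial.aeval g (MvPolynomial.pderiv s p) * MvPolynomial.pderiv j (g s) := by
  classical
  induction p using MvPolynomial.induction_on with
  | C a => simp [MvPolynomial.algebraMap_eq]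
  | add p q hp hq => simp only [map_add, hp, hq, add_mul, Finset.sum_add_distrib]
  | mul_X p n hp =>
    simp only [map_mul, MvPolynomial.aeval_X, Derivation.leibniz, MvPolynomial.pderiv_X, smul_eq_mul,
      map_add, add_mul, Finset.sum_add_distrib, hp, Finset.mul_sum]
    congr 1
    · rw [Finset.sum_eq_single n]
      · simp
      · intro b _ hb; simp [hb.symm]
      · simp
    · exact Finset.sum_congr rfl fun s _ => by ring

theorem card_compressed_zeros_le {K σ ι : Type*} [Field K] [Fintype K] [DecidableEq K] [Fintype σ]
    [Fintype ι] {R d : ℕ}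
    (F : ι → MvPolynomial σ K) (hd : ∀ i, (F i).totalDegree ≤ d) (Y : Finset (σ → K))
    (hY : ∀ z ∈ Y, ∀ i, MvPolynomial.eval z (F i) = 0) (U : Matrix (Fin R) ι K)
    (W : Matrix σ (Fin R) K)
    (hdet : ∀ z ∈ Y, (U * Matrix.of (fun i s => MvPolynomial.eval z (MvPolynomial.pderiv s (F i))) *
      W).det ≠ 0) :
    Fintype.card K ^ R * Y.card ≤ Fintype.card K ^ Fintype.card σ * (d * R + 2) ^ R := by
  classical
  have h1 : ∀ z0 : σ → K, ({u : Fin R → K | z0 + W.mulVec u ∈ Y} : Finset _).card ≤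
      (d * R + 2) ^ R := by
    intro z0
    let g : σ → MvPolynomial (Fin R) K := fun s =>
      MvPolynomial.C (z0 s) + ∑ j, MvPolynomial.C (W s j) * MvPolynomial.X j
    have hg1 : ∀ s, (g s).totalDegree ≤ 1 := by
      intro s
      refine (MvPolynomial.totalDegree_add _ _).trans (max_le (by simp) ?_)
      refine MvPolynomial.totalDegree_finsetSum_le fun j _ => ?_
      refine (MvPolynomial.totalDegree_mul _ _).trans ?_
      simp
    have hg2 : ∀ s j, MvPolynomial.pderiv j (g s) = MvPolynomial.C (W s j) := by
      intro s j
      simp only [g, map_add, map_sum, MvPolynomial.pderiv_C,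
        MvPolynomial.pderiv_X, zero_add, MvPolynomial.pderiv_C_mul]
      rw [Finset.sum_eq_single j]
      · simp
      · intro b _ hb; simp [hb]
      · simp
    have hev : ∀ u p, MvPolynomial.eval u (MvPolynomial.aeval g p) =
        MvPolynomial.eval (z0 + W.mulVec u) p := by
      intro u p
      have := MvPolynomial.comp_aeval_apply (f := g) (φ := (MvPolynomial.aeval u : MvPolynomial (Fin R) K →ₐ[K] K)) p
      simp only [MvPolynomial.aeval_eq_eval] at this ⊢
      change MvPolynomial.eval u _ = _ at this
      rw [this]
      change MvPolynomial.eval _ p = _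
      congr 2
      funext s
      simp [g, Matrix.mulVec, dotProduct]
    refine card_nonsingular_zeros_le
      (fun l => ∑ i, MvPolynomial.C (U l i) * MvPolynomial.aeval g (F i)) (fun l => ?_) _ ?_ ?_
    · refine MvPolynomial.totalDegree_finsetSum_le fun i _ => ?_
      refine (MvPolynomial.totalDegree_mul _ _).trans ?_
      rw [MvPolynomial.totalDegree_C, zero_add]
      exact (totalDegree_aeval_le g hg1 _).trans (hd i)
    · intro u hu l
      simp only [Finset.mem_filter, Finset.mem_univ, true_and] at hu
      simp only [map_sum, map_mul, hev, hY _ hu, mul_zero, Finset.sum_const_zero]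
    · intro u hu
      simp only [Finset.mem_filter, Finset.mem_univ, true_and] at hu
      convert hdet _ hu using 2
      ext l j
      simp only [Matrix.of_apply, Matrix.mul_apply, map_sum, MvPolynomial.pderiv_C_mul,
        pderiv_aeval, hg2, map_mul, hev, MvPolynomial.eval_C,
        Finset.mul_sum, Finset.sum_mul]
      rw [Finset.sum_comm]
      exact Finset.sum_congr rfl fun s _ => Finset.sum_congr rfl fun i _ => by ring
  have h2 : ∑ z0 : σ → K, ({u : Fin R → K | z0 + W.mulVec u ∈ Y} : Finset _).card =
      Fintype.card K ^ R * Y.card := by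
    simp only [Finset.card_filter]
    rw [Finset.sum_comm]
    have : ∀ u : Fin R → K, ∑ z0 : σ → K, (if z0 + W.mulVec u ∈ Y then 1 else 0) = Y.card := by
      intro u
      exact ((Equiv.addRight (W.mulVec u)).sum_comp Finset.univ (fun z => if z ∈ Y then 1 else 0)
        (by simp)).trans (by simp)
    simp [this]
  rw [← h2]
  refine (Finset.sum_le_card_nsmul _ _ _ fun z0 _ => h1 z0).trans ?_
  simp

/-- An averaged Bézout bound: common zeros at which the Jacobian has large rank are rare. -/
theorem card_large_rank_zeros_le {K σ ι : Type*} [Field K] [Fintype K] [DecidableEq K] [Fintype σ]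
    [DecidableEq σ] [Fintype ι] [DecidableEq ι] {R d : ℕ}
    (F : ι → MvPolynomial σ K) (hd : ∀ i, (F i).totalDegree ≤ d) (Y : Finset (σ → K))
    (hY : ∀ z ∈ Y, ∀ i, MvPolynomial.eval z (F i) = 0)
    (hR : ∀ z ∈ Y,
      R ≤ (Matrix.of (fun i s => MvPolynomial.eval z (MvPolynomial.pderiv s (F i)))).rank)
    (hq : 4 * R ≤ Fintype.card K) :
    Fintype.card K ^ R * Y.card ≤ 2 * (Fintype.card K ^ Fintype.card σ * (d * R + 2) ^ R) := by
  obtain ⟨U, W, hUW⟩ := exists_common_compression Y _ hR hq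
  have := card_compressed_zeros_le F hd _ (fun z hz => hY z (Finset.mem_filter.mp hz).1) U W
    (fun z hz => (Finset.mem_filter.mp hz).2)
  calc _ ≤ Fintype.card K ^ R * (2 * _) := Nat.mul_le_mul_left _ hUW
    _ = 2 * (Fintype.card K ^ R * _) := by ring
    _ ≤ _ := Nat.mul_le_mul_left _ this

/-- For `P = U A W`, the matrix `det P • A - A W adj(P) U A`, which vanishes when `A` has rank equal
to the size of `P` and `P` is invertible. -/
def schurDefect {ι σ S : Type*} [CommRing S] [Fintype ι] [Fintype σ] {s : ℕ}
    (U : Matrix (Fin s) ι S) (A : Matrix ι σ S) (W : Matrix σ (Fin s) S) : Matrix ι σ S :=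
  (U * A * W).det • A - A * W * (U * A * W).adjugate * (U * A)

theorem schurDefect_map {ι σ S T : Type*} [CommRing S] [CommRing T] [Fintype ι] [Fintype σ] {s : ℕ}
    (U : Matrix (Fin s) ι S) (A : Matrix ι σ S) (W : Matrix σ (Fin s) S) (φ : S →+* T) :
    (schurDefect U A W).map φ = schurDefect (U.map φ) (A.map φ) (W.map φ) := by
  have h1 : (U * A * W).map φ = U.map φ * A.map φ * W.map φ := by
    rw [Matrix.map_mul, Matrix.map_mul]
  have h2 : (U * A * W).adjugate.map φ = (U.map φ * A.map φ * W.map φ).adjugate := by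
    rw [← h1]; exact φ.map_adjugate _
  have h3 : φ (U * A * W).det = (U.map φ * A.map φ * W.map φ).det := by
    rw [← h1]; exact φ.map_det _
  unfold schurDefect
  rw [Matrix.map_sub _ (by simp), Matrix.map_mul, Matrix.map_mul, Matrix.map_mul, Matrix.map_mul, h2,
    ← h3]
  congr 1
  ext i j
  simp

theorem totalDegree_schurDefect_le {K σ ι τ : Type*} [Field K] [Fintype ι] [Fintype σ] {s d : ℕ}
    (U : Matrix (Fin s) ι K) (A : Matrix ι σ (MvPolynomial τ K)) (W : Matrix σ (Fin s) K)
    (hA : ∀ i j, (A i j).totalDegree ≤ d) (i : ι) (j : σ) :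
    (schurDefect (U.map MvPolynomial.C) A (W.map MvPolynomial.C) i j).totalDegree ≤ (s + 2) * d := by
  have hU : ∀ i j, ((U.map MvPolynomial.C : Matrix _ _ (MvPolynomial τ K)) i j).totalDegree ≤ 0 := by
    simp
  have hW : ∀ i j, ((W.map MvPolynomial.C : Matrix _ _ (MvPolynomial τ K)) i j).totalDegree ≤ 0 := by
    simp
  have hUA := totalDegree_mul_apply_le _ _ hU hA
  have hAW := totalDegree_mul_apply_le _ _ hA hW
  have hP := totalDegree_mul_apply_le _ _ hUA hW
  have hdet := totalDegree_det_le _ hP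
  have hadj := totalDegree_adjugate_le _ hP
  have h2 := totalDegree_mul_apply_le _ _ (totalDegree_mul_apply_le _ _ hAW hadj) hUA
  simp only [Fintype.card_fin, zero_add, add_zero] at hdet h2
  unfold schurDefect
  rw [Matrix.sub_apply, Matrix.smul_apply, smul_eq_mul]
  refine (MvPolynomial.totalDegree_sub _ _).trans (max_le ?_ ?_)
  · refine (MvPolynomial.totalDegree_mul _ _).trans ?_
    have := hA i j
    nlinarith
  · refine (h2 i j).trans (le_of_eq (by ring))

/-- Evaluation at the point `z` perturbed by `τ` in the blocks with index below `j`. -/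
noncomputable def jet {K σ B : Type*} [Field K] [CommRing B] [Algebra K B] (blk : σ → ℕ) (τ : σ → B)
    (j : ℕ) (z : σ → K) : MvPolynomial σ K →ₐ[K] B :=
  MvPolynomial.aeval fun s => algebraMap K B (z s) + if blk s < j then τ s else 0

theorem augmentation_jet {K σ B : Type*} [Field K] [CommRing B] [Algebra K B] (ε : B →ₐ[K] K)
    (blk : σ → ℕ) (τ : σ → B) (hτ : ∀ s, ε (τ s) = 0) (j : ℕ) (z : σ → K) (p : MvPolynomial σ K) :
    ε (jet blk τ j z p) = MvPolynomial.eval z p := by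
  unfold jet
  rw [← AlgHom.comp_apply, MvPolynomial.comp_aeval, ← MvPolynomial.aeval_eq_eval]
  change MvPolynomial.aeval _ p = MvPolynomial.aeval _ p
  congr 2
  funext s
  split_ifs <;> simp [hτ]

theorem jet_succ {K σ B : Type*} [Field K] [Fintype σ] [CommRing B] [Algebra K B]
    (blk : σ → ℕ) (τ : σ → B) (hττ : ∀ s t, blk s = blk t → τ s * τ t = 0)
    (j : ℕ) (z : σ → K) (p : MvPolynomial σ K) :
    jet blk τ (j + 1) z p = jet blk τ j z p +
      ∑ s, jet blk τ j z (if blk s = j then MvPolynomial.pderiv s p else 0) * τ s := by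
  have h := aeval_add_sub_mem (⊥ : Ideal B)
    (fun s => algebraMap K B (z s) + if blk s < j then τ s else 0)
    (fun s => if blk s = j then τ s else 0) (fun s t => by
      rw [Ideal.mem_bot]
      split_ifs with h1 h2
      · exact hττ s t (h1.trans h2.symm)
      all_goals simp) p
  rw [Ideal.mem_bot, sub_eq_zero] at h
  have h1 : jet blk τ (j + 1) z p = MvPolynomial.aeval (fun s =>
      (algebraMap K B (z s) + if blk s < j then τ s else 0) + if blk s = j then τ s else 0) p := by
    unfold jet
    congr 2
    funext s
    rcases lt_trichotomy (blk s) j with h | h | h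
    · rw [if_pos (by omega), if_pos h, if_neg (by omega), add_zero]
    · rw [if_pos (by omega), if_neg (by omega), if_pos h, add_zero]
    · rw [if_neg (by omega), if_neg (by omega), if_neg (by omega)]; simp
  rw [h1, h]
  refine congrArg₂ _ rfl (Finset.sum_congr rfl fun s _ => ?_)
  split_ifs <;> simp [jet]

theorem exists_dense_fixed_rank {K σ ι : Type*} [Field K] [Fintype K] [DecidableEq K] [Fintype σ]
    [DecidableEq σ] [Fintype ι] [DecidableEq ι] {h e d : ℕ} (X : Finset (σ → K))
    (F : ι → MvPolynomial σ K) (hd1 : 1 ≤ d) (hd : ∀ i, (F i).totalDegree ≤ d)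
    (hX : ∀ z ∈ X, ∀ i, MvPolynomial.eval z (F i) = 0)
    (hcard : Fintype.card K ^ Fintype.card σ ≤ X.card * Fintype.card K ^ e) (he : e + 1 ≤ h)
    (hq : (d * (2 * h) + 2) ^ 2 ≤ Fintype.card K) (T : σ → Prop) [DecidablePred T] :
    ∃ s < 2 * h, ∃ (U : Matrix (Fin s) ι K) (W : Matrix σ (Fin s) K) (X' : Finset (σ → K)), X' ⊆ X ∧
      Fintype.card K ^ Fintype.card σ ≤ X'.card * Fintype.card K ^ (e + 1) ∧
      ∀ z ∈ X', (Matrix.of fun i t => MvPolynomial.eval z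
          (if T t then MvPolynomial.pderiv t (F i) else 0)).rank = s ∧
        (U * (Matrix.of fun i t => MvPolynomial.eval z
          (if T t then MvPolynomial.pderiv t (F i) else 0)) * W).det ≠ 0 := by
  set q := Fintype.card K
  set R := 2 * h with hR
  let A : (σ → K) → Matrix ι σ K := fun z =>
    Matrix.of fun i t => MvPolynomial.eval z (if T t then MvPolynomial.pderiv t (F i) else 0)
  have hq4 : 4 * R ≤ q := by
    have := Nat.le_mul_of_pos_left R hd1
    nlinarith
  have hq0 : 0 < q := Fintype.card_pos
  have hrank : ∀ z, (A z).rank ≤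
      (Matrix.of (fun i s => MvPolynomial.eval z (MvPolynomial.pderiv s (F i)))).rank := by
    intro z
    have : A z = (Matrix.of (fun i s => MvPolynomial.eval z (MvPolynomial.pderiv s (F i)))) *
        Matrix.diagonal fun t => if T t then (1 : K) else 0 := by
      ext i t
      rw [Matrix.mul_diagonal]
      simp only [A, Matrix.of_apply]
      split_ifs <;> simp
    rw [this]
    exact Matrix.rank_mul_le_left _ _
  have hY := card_large_rank_zeros_le F hd {z ∈ X | R ≤ (A z).rank}
    (fun z hz => hX z (Finset.mem_filter.mp hz).1)
    (fun z hz => (Finset.mem_filter.mp hz).2.trans (hrank z)) hq4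
  set Y := ({z ∈ X | R ≤ (A z).rank} : Finset _)
  have hY2 : 2 * Y.card ≤ X.card := by
    have h1 : (d * R + 2) ^ R ≤ q ^ h := by
      rw [hR, pow_mul]; exact Nat.pow_le_pow_left hq h
    have h2 : q ^ (e + h) * (q * Y.card) ≤ q ^ (e + h) * (2 * X.card) := by
      calc q ^ (e + h) * (q * Y.card) = q ^ (e + h + 1) * Y.card := by ring
        _ ≤ q ^ R * Y.card := Nat.mul_le_mul_right _ (Nat.pow_le_pow_right hq0 (by omega))
        _ ≤ 2 * (q ^ Fintype.card σ * (d * R + 2) ^ R) := hY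
        _ ≤ 2 * ((X.card * q ^ e) * q ^ h) := Nat.mul_le_mul_left _ (Nat.mul_le_mul hcard h1)
        _ = q ^ (e + h) * (2 * X.card) := by ring
    have h3 := Nat.le_of_mul_le_mul_left h2 (by positivity)
    have : 4 * Y.card ≤ q * Y.card := Nat.mul_le_mul_right _ (by omega)
    omega
  have hYc : X.card ≤ 2 * ({z ∈ X | ¬ R ≤ (A z).rank} : Finset _).card := by
    have : Y.card + _ = _ := Finset.card_filter_add_card_filter_not (s := X) (fun z => R ≤ (A z).rank)
    omega
  obtain ⟨s, hs, hXs⟩ : ∃ s < R, X.card ≤ 2 * R * ({z ∈ X | (A z).rank = s} : Finset _).card := by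
    by_contra! hcon
    have h1 : ({z ∈ X | ¬ R ≤ (A z).rank} : Finset _).card =
        ∑ s ∈ Finset.range R, ({z ∈ X | (A z).rank = s} : Finset _).card := by
      rw [Finset.card_eq_sum_card_fiberwise (f := fun z => (A z).rank) (t := Finset.range R)]
      · refine Finset.sum_congr rfl fun s hs => congrArg _ ?_
        ext z
        simp only [Finset.mem_filter, and_assoc, Finset.mem_range] at hs ⊢
        refine and_congr_right fun _ => ⟨fun h => h.2, fun h => ⟨by omega, h⟩⟩
      · intro z hz
        simp at hz ⊢
        exact hz.2
    have h2 : ∑ s ∈ Finset.range R, 2 * R * ({z ∈ X | (A z).rank = s} : Finset _).card <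
        ∑ s ∈ Finset.range R, X.card :=
      Finset.sum_lt_sum_of_nonempty (by simp; omega) fun s hs => hcon s (Finset.mem_range.mp hs)
    rw [← Finset.mul_sum, ← h1, Finset.sum_const, Finset.card_range, smul_eq_mul] at h2
    have := Nat.mul_le_mul_left R hYc
    nlinarith
  obtain ⟨U, W, hUW⟩ := exists_common_compression {z ∈ X | (A z).rank = s} A (r := s)
    (fun z hz => (Finset.mem_filter.mp hz).2.ge) (by omega)
  refine ⟨s, hs, U, W, _, ((Finset.filter_subset _ _).trans (Finset.filter_subset _ _)), ?_,
    fun z hz => ⟨(Finset.mem_filter.mp (Finset.mem_filter.mp hz).1).2, (Finset.mem_filter.mp hz).2⟩⟩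
  set X' := Finset.filter (fun z => (U * A z * W).det ≠ 0) {z ∈ X | (A z).rank = s}
  have h4 : X.card ≤ q * X'.card := by
    calc X.card ≤ 2 * R * (2 * X'.card) := hXs.trans (Nat.mul_le_mul_left _ hUW)
      _ = (4 * R) * X'.card := by ring
      _ ≤ _ := Nat.mul_le_mul_right _ hq4
  calc _ ≤ X.card * q ^ e := hcard
    _ ≤ q * X'.card * q ^ e := Nat.mul_le_mul_right _ h4
    _ = _ := by ring

universe u in
/-- At some common zero, the formal perturbations of the `F i` lie in an ideal with few generators,
all without constant term. -/
theorem exists_few_generators {K B : Type*} {σ : Type u} [Field K] [Fintype K] [DecidableEq K]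
    [Fintype σ] [DecidableEq σ] [CommRing B] [Algebra K B] (ε : B →ₐ[K] K)
    (hunit : ∀ b, ε b ≠ 0 → IsUnit b) (blk : σ → ℕ) (τ : σ → B) (hτ : ∀ s, ε (τ s) = 0)
    (hττ : ∀ s t, blk s = blk t → τ s * τ t = 0) (h j : ℕ) :
    ∀ (e d : ℕ) (ι : Type u) [Fintype ι] (X : Finset (σ → K)) (F : ι → MvPolynomial σ K), 1 ≤ d →
      (∀ i, (F i).totalDegree ≤ d) → (∀ z ∈ X, ∀ i, MvPolynomial.eval z (F i) = 0) →
      Fintype.card K ^ Fintype.card σ ≤ X.card * Fintype.card K ^ e → e + j + 1 ≤ h →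
      (d * (2 * h + 1) ^ j * (2 * h) + 2) ^ 2 ≤ Fintype.card K →
      ∃ z ∈ X, ∃ S : Finset B, S.card ≤ j * (2 * h) ∧ (∀ b ∈ S, ε b = 0) ∧
        ∀ i, jet blk τ j z (F i) ∈ Ideal.span (S : Set B) := by
  classical
  induction j with
  | zero =>
    intro e d ι _ X F _ _ hX hcard _ _
    have hpos : 0 < X.card := by
      by_contra h0
      have : 0 < Fintype.card K ^ Fintype.card σ := pow_pos Fintype.card_pos _
      simp only [not_lt, nonpos_iff_eq_zero] at h0
      rw [h0, zero_mul] at hcard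
      omega
    obtain ⟨z, hz⟩ := Finset.card_pos.mp hpos
    refine ⟨z, hz, ∅, by simp, by simp, fun i => ?_⟩
    have : jet blk τ 0 z (F i) = algebraMap K B (MvPolynomial.eval z (F i)) := by
      have := MvPolynomial.aeval_algebraMap_apply B z (F i)
      rw [MvPolynomial.aeval_eq_eval] at this
      simpa [jet, Function.comp_def] using this
    rw [this, hX z hz i]
    simp
  | succ j ih =>
    intro e d ι _ X F hd1 hd hX hcard he hq
    obtain ⟨s, hs, U, W, X', hX'X, hX'card, hX'⟩ := exists_dense_fixed_rank (h := h) X F hd1 hd hX hcard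
      (by omega) (le_trans (Nat.pow_le_pow_left (by
        have : 1 ≤ (2 * h + 1) ^ (j + 1) := Nat.one_le_pow _ _ (by omega)
        nlinarith [Nat.mul_le_mul_left (d * (2 * h)) this]) 2) hq) (fun t => blk t = j)
    let A : Matrix ι σ (MvPolynomial σ K) :=
      Matrix.of fun i t => if blk t = j then MvPolynomial.pderiv t (F i) else 0
    have hA : ∀ i t, (A i t).totalDegree ≤ d := by
      intro i t
      simp only [A, Matrix.of_apply]
      split_ifs
      · exact (totalDegree_pderiv_le_totalDegree _ _).trans (hd i)
      · simp
    let F' : ι ⊕ ι × σ → MvPolynomial σ K := Sum.elim F fun x =>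
      schurDefect (U.map MvPolynomial.C) A (W.map MvPolynomial.C) x.1 x.2
    obtain ⟨z, hz, S, hS, hεS, hmem⟩ := ih (e + 1) ((2 * h + 1) * d) (ι ⊕ ι × σ) X' F'
      (by nlinarith) (by
        rintro (i | x)
        · exact (hd i).trans (by nlinarith)
        · exact (totalDegree_schurDefect_le U A W hA _ _).trans (Nat.mul_le_mul_right _ (by omega)))
      (by
        rintro z hz (i | x)
        · exact hX z (hX'X hz) i
        · have h1 := schurDefect_map (U.map MvPolynomial.C) A (W.map MvPolynomial.C) (MvPolynomial.eval z)
          have h2 := schur_eq_zero (A.map (MvPolynomial.eval z)) (hX' z hz).1 U W (hX' z hz).2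
          have hU : (U.map MvPolynomial.C).map (MvPolynomial.eval z) = U := by ext; simp
          have hW : (W.map MvPolynomial.C).map (MvPolynomial.eval z) = W := by ext; simp
          rw [hU, hW] at h1
          exact congrFun (congrFun (h1.trans h2) x.1) x.2)
      hX'card (by omega) (le_trans (le_of_eq (by ring)) hq)
    refine ⟨z, hX'X hz, ?_⟩
    set φ := jet blk τ j z with hφ
    let U' : Matrix (Fin s) ι B := U.map (algebraMap K B)
    let W' : Matrix σ (Fin s) B := W.map (algebraMap K B)
    let A' : Matrix ι σ B := A.map φ
    let g : Fin s → B := (U' * A').mulVec τ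
    refine ⟨S ∪ Finset.univ.image g, ?_, ?_, ?_⟩
    · refine (Finset.card_union_le _ _).trans ?_
      have : (Finset.univ.image g).card ≤ s := Finset.card_image_le.trans (by simp)
      nlinarith
    · intro b hb
      rcases Finset.mem_union.mp hb with hb | hb
      · exact hεS b hb
      · obtain ⟨l, -, rfl⟩ := Finset.mem_image.mp hb
        simp [g, Matrix.mulVec, dotProduct, hτ]
    · intro i
      have hsub : Ideal.span (S : Set B) ≤ Ideal.span ((S ∪ Finset.univ.image g : Finset B) : Set B) :=
        Ideal.span_mono (by simp)
      have hg : ∀ l, g l ∈ Ideal.span ((S ∪ Finset.univ.image g : Finset B) : Set B) := fun l =>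
        Ideal.subset_span (by simp)
      rw [jet_succ blk τ hττ]
      refine Ideal.add_mem _ (hsub (hmem (Sum.inl i))) ?_
      have hU : (U.map MvPolynomial.C).map φ.toRingHom = U' := by
        ext; exact φ.commutes _
      have hW : (W.map MvPolynomial.C).map φ.toRingHom = W' := by
        ext; exact φ.commutes _
      have h1 := schurDefect_map (U.map MvPolynomial.C) A (W.map MvPolynomial.C) φ.toRingHom
      rw [hU, hW] at h1
      have hunitdet : IsUnit (U' * A' * W').det := by
        apply hunit
        have : ε (U' * A' * W').det = (U * (A.map (MvPolynomial.eval z)) * W).det := by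
          rw [AlgHom.map_det]
          congr 1
          ext a b
          simp [Matrix.mul_apply, U', W', A', φ, augmentation_jet ε blk τ hτ]
        rw [this]
        exact (hX' z hz).2
      rw [← Ideal.unit_mul_mem_iff_mem _ hunitdet]
      have h2 : (U' * A' * W').det * ∑ t, φ (if blk t = j then MvPolynomial.pderiv t (F i) else 0) * τ t
          = (∑ t, schurDefect U' A' W' i t * τ t) +
            ∑ l, (A' * W' * (U' * A' * W').adjugate) i l * g l := by
        have h3 : (A' * W' * (U' * A' * W').adjugate).mulVec g =
            (A' * W' * (U' * A' * W').adjugate * (U' * A')).mulVec τ := by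
          simp only [g, Matrix.mulVec_mulVec]
        have h4 := congrFun h3 i
        simp only [Matrix.mulVec, dotProduct] at h4
        rw [h4, ← Finset.sum_add_distrib, Finset.mul_sum]
        refine Finset.sum_congr rfl fun t _ => ?_
        rw [← add_mul]
        simp only [schurDefect, Matrix.sub_apply, Matrix.smul_apply, smul_eq_mul, sub_add_cancel]
        rw [← mul_assoc]
        rfl
      rw [h2]
      refine Ideal.add_mem _ (Ideal.sum_mem _ fun t _ => Ideal.mul_mem_right _ _ (hsub ?_))
        (Ideal.sum_mem _ fun l _ => Ideal.mul_mem_left _ _ (hg l))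
      have h5 := hmem (Sum.inr (i, t))
      have h6 := congrFun (congrFun h1 i) t
      exact h6 ▸ h5

/-- The exponent of `∏_{i ∈ I} X_{i, a i}`. -/
noncomputable def blockExp {n : ℕ} {ι : Fin n → Type} [∀ i, DecidableEq (ι i)] [∀ i, Fintype (ι i)]
    (I : Finset (Fin n)) (a : ∀ i, ι i) : (Σ i, ι i) →₀ ℕ :=
  Finsupp.equivFunOnFinite.symm fun s => if s.1 ∈ I ∧ s.2 = a s.1 then 1 else 0

theorem blockExp_apply {n : ℕ} {ι : Fin n → Type} [∀ i, DecidableEq (ι i)] [∀ i, Fintype (ι i)]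
    (I : Finset (Fin n)) (a : ∀ i, ι i) (s : Σ i, ι i) :
    blockExp I a s = if s.1 ∈ I ∧ s.2 = a s.1 then 1 else 0 := rfl

theorem blockExp_congr {n : ℕ} {ι : Fin n → Type} [∀ i, DecidableEq (ι i)] [∀ i, Fintype (ι i)]
    {I : Finset (Fin n)} {a a' : ∀ i, ι i} (h : ∀ i ∈ I, a i = a' i) :
    blockExp I a = blockExp I a' := by
  ext s
  simp only [blockExp_apply]
  by_cases hs : s.1 ∈ I
  · simp [hs, h _ hs]
  · simp [hs]

theorem prod_X_eq_monomial_blockExp {K : Type*} [Field K] {n : ℕ} {ι : Fin n → Type}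
    [∀ i, DecidableEq (ι i)] [∀ i, Fintype (ι i)] (I : Finset (Fin n)) (a : ∀ i, ι i) :
    ∏ i ∈ I, (MvPowerSeries.X ⟨i, a i⟩ : MvPowerSeries (Σ i, ι i) K) =
      MvPowerSeries.monomial (blockExp I a) 1 := by
  simp only [MvPowerSeries.X_def, MvPowerSeries.prod_monomial, Finset.prod_const_one]
  congr 2
  ext ⟨i, b⟩
  rw [Finsupp.finsetSum_apply, blockExp_apply]
  simp only [Finsupp.single_apply, Sigma.mk.injEq]
  by_cases hi : i ∈ I
  · rw [Finset.sum_eq_single i]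
    · simp [hi, eq_comm]
    · intro j _ hj; simp [hj]
    · exact fun h => absurd hi h
  · rw [if_neg (by simp [hi])]
    refine Finset.sum_eq_zero fun j hj => if_neg ?_
    rintro ⟨rfl, -⟩
    exact hi hj

theorem coeff_mul_blockExp {K : Type*} [Field K] {n : ℕ} {ι : Fin n → Type}
    [∀ i, DecidableEq (ι i)] [∀ i, Fintype (ι i)] (a : ∀ i, ι i)
    (f g : MvPowerSeries (Σ i, ι i) K) :
    MvPowerSeries.coeff (blockExp Finset.univ a) (f * g) = ∑ I : Finset (Fin n),
      MvPowerSeries.coeff (blockExp I a) f * MvPowerSeries.coeff (blockExp Iᶜ a) g := by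
  classical
  rw [MvPowerSeries.coeff_mul]
  symm
  refine Finset.sum_bij (fun I _ => (blockExp I a, blockExp Iᶜ a)) ?_ ?_ ?_ fun _ _ => rfl
  · intro I _
    rw [Finset.HasAntidiagonal.mem_antidiagonal]
    ext s
    simp only [Finsupp.add_apply, blockExp_apply, Finset.mem_compl, Finset.mem_univ, true_and]
    by_cases h1 : s.1 ∈ I <;> by_cases h2 : s.2 = a s.1 <;> simp [h1, h2]
  · intro I _ J _ h
    ext i
    have := DFunLike.congr_fun (Prod.ext_iff.mp h).1 (⟨i, a i⟩ : Σ i, ι i)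
    simp only [blockExp_apply] at this
    by_cases h1 : i ∈ I <;> by_cases h2 : i ∈ J <;> simp_all
  · rintro ⟨u, v⟩ huv
    rw [Finset.HasAntidiagonal.mem_antidiagonal] at huv
    have h : ∀ s, u s + v s = if s.2 = a s.1 then 1 else 0 := by
      intro s
      have := DFunLike.congr_fun huv s
      simpa [blockExp_apply] using this
    refine ⟨({i | u ⟨i, a i⟩ ≠ 0} : Finset (Fin n)), Finset.mem_univ _, ?_⟩
    have key : ∀ s : Σ i, ι i, (blockExp {i | u ⟨i, a i⟩ ≠ 0} a) s = u s ∧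
        (blockExp ({i | u ⟨i, a i⟩ ≠ 0} : Finset (Fin n))ᶜ a) s = v s := by
      rintro ⟨i, b⟩
      have := h ⟨i, b⟩
      simp only [blockExp_apply, Finset.mem_compl, Finset.mem_filter, Finset.mem_univ, true_and]
      simp only at this
      by_cases hb : b = a i
      · subst hb
        simp only [if_true] at this
        simp only [and_true]
        split_ifs <;> omega
      · simp only [hb, if_false, and_false] at this ⊢
        omega
    exact Prod.ext (Finsupp.ext fun s => (key s).1) (Finsupp.ext fun s => (key s).2)

theorem coeff_shifted_tensor {K : Type*} [Field K] {n : ℕ} {ι : Fin n → Type}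
    [∀ i, DecidableEq (ι i)] [∀ i, Fintype (ι i)] (t : (∀ i, ι i) → K) (z : (Σ i, ι i) → K)
    (a : ∀ i, ι i) :
    MvPowerSeries.coeff (blockExp Finset.univ a) (∑ a', algebraMap K _ (t a') *
      ∏ i, (algebraMap K (MvPowerSeries (Σ i, ι i) K) (z ⟨i, a' i⟩) + MvPowerSeries.X ⟨i, a' i⟩)) =
      t a := by
  classical
  rw [map_sum]
  have h : ∀ a', MvPowerSeries.coeff (blockExp Finset.univ a) (algebraMap K _ (t a') *
      ∏ i, (algebraMap K (MvPowerSeries (Σ i, ι i) K) (z ⟨i, a' i⟩) + MvPowerSeries.X ⟨i, a' i⟩)) =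
      if a' = a then t a' else 0 := by
    intro a'
    rw [Finset.prod_add]
    simp only [prod_X_eq_monomial_blockExp, ← map_prod]
    simp only [MvPowerSeries.algebraMap_apply, Algebra.algebraMap_self, RingHom.id_apply,
      MvPowerSeries.coeff_C_mul, map_sum, MvPowerSeries.coeff_monomial]
    have h2 : ∀ I : Finset (Fin n), blockExp Finset.univ a = blockExp (Finset.univ \ I) a' ↔
        I = ∅ ∧ a' = a := by
      intro I
      constructor
      · intro h
        have h3 : ∀ i, i ∉ I ∧ a i = a' i := by
          intro i
          have := DFunLike.congr_fun h (⟨i, a i⟩ : Σ i, ι i)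
          simp only [blockExp_apply, Finset.mem_univ, true_and, if_true, Finset.mem_sdiff] at this
          by_contra hc
          rw [if_neg hc] at this
          omega
        exact ⟨Finset.eq_empty_of_forall_notMem fun i => (h3 i).1, funext fun i => (h3 i).2.symm⟩
      · rintro ⟨rfl, rfl⟩; simp
    simp only [h2]
    by_cases ha : a' = a
    · rw [Finset.sum_eq_single ∅]
      · simp [ha]
      · intro I _ hI; simp [hI]
      · simp
    · simp [ha]
  simp only [h]
  simp

/-- Power series all of whose coefficients at block-multilinear exponents vanish. -/
def nonMultilinearIdeal (K : Type*) [Field K] {n : ℕ} (ι : Fin n → Type) :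
    Ideal (MvPowerSeries (Σ i, ι i) K) where
  carrier := {f | ∀ m : (Σ i, ι i) →₀ ℕ, (∀ s t : Σ i, ι i, s.1 = t.1 → Finsupp.single s 1 +
    Finsupp.single t 1 ≤ m → False) → MvPowerSeries.coeff m f = 0}
  zero_mem' := by simp
  add_mem' := by
    intro f g hf hg m hm
    rw [map_add, hf m hm, hg m hm, add_zero]
  smul_mem' := by
    classical
    intro f g hg m hm
    rw [smul_eq_mul, MvPowerSeries.coeff_mul]
    refine Finset.sum_eq_zero fun x hx => ?_
    rw [hg x.2 fun s t hst h => hm s t hst (h.trans ?_), mul_zero]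
    rw [← Finset.HasAntidiagonal.mem_antidiagonal.mp hx]
    exact self_le_add_left _ _

theorem coeff_blockExp_eq_zero {K : Type*} [Field K] {n : ℕ} {ι : Fin n → Type}
    [∀ i, DecidableEq (ι i)] [∀ i, Fintype (ι i)] {f : MvPowerSeries (Σ i, ι i) K}
    (hf : f ∈ nonMultilinearIdeal K ι) (I : Finset (Fin n)) (a : ∀ i, ι i) :
    MvPowerSeries.coeff (blockExp I a) f = 0 := by
  classical
  refine hf _ fun s t hst h => ?_
  have h1 := h s
  have h2 := h t
  simp only [Finsupp.add_apply, Finsupp.single_apply, blockExp_apply, if_true] at h1 h2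
  obtain ⟨i, b⟩ := s
  obtain ⟨j, c⟩ := t
  obtain rfl : i = j := hst
  by_cases hbc : b = c
  · subst hbc
    simp only [if_true] at h1
    split_ifs at h1 <;> omega
  · simp only [Sigma.mk.injEq, heq_eq_eq, true_and, hbc, Ne.symm hbc, if_false] at h1 h2
    split_ifs at h1 h2 with h3 h4
    · exact hbc (h3.2.trans h4.2.symm)
    all_goals omega

theorem X_mul_X_mem_nonMultilinearIdeal {K : Type*} [Field K] {n : ℕ} {ι : Fin n → Type}
    (s t : Σ i, ι i) (h : s.1 = t.1) :
    (MvPowerSeries.X s * MvPowerSeries.X t : MvPowerSeries (Σ i, ι i) K) ∈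
      nonMultilinearIdeal K ι := by
  classical
  intro m hm
  rw [MvPowerSeries.X_def, MvPowerSeries.X_def, MvPowerSeries.monomial_mul_monomial,
    MvPowerSeries.coeff_monomial, if_neg]
  intro hmeq
  exact hm s t h hmeq.ge

theorem constantCoeff_eq_zero_of_mem {K : Type*} [Field K] {n : ℕ} {ι : Fin n → Type}
    {f : MvPowerSeries (Σ i, ι i) K} (hf : f ∈ nonMultilinearIdeal K ι) :
    MvPowerSeries.constantCoeff f = 0 := by
  rw [← MvPowerSeries.coeff_zero_eq_constantCoeff_apply]
  refine hf 0 fun s t _ h => ?_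
  have := h s
  simp at this

/-- A tensor whose associated system has many zeros is a sum of few products. -/
theorem tensor_decomposition_of_dense_zeros {K : Type} [Field K] [Fintype K] [DecidableEq K] {n : ℕ}
    {ι : Fin n → Type} [∀ i, DecidableEq (ι i)] [∀ i, Fintype (ι i)] {κ : Type} [Fintype κ]
    (t : (∀ i, ι i) → κ → K) {e h : ℕ} (he : e + n + 1 ≤ h)
    (hq : ((n + 1) * (2 * h + 1) ^ n * (2 * h) + 2) ^ 2 ≤ Fintype.card K)
    (hdense : Fintype.card K ^ Fintype.card (Σ i, ι i) ≤
      ({z | ∀ c, ∑ a, t a c * ∏ i, z ⟨i, a i⟩ = 0} : Finset ((Σ i, ι i) → K)).card *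
        Fintype.card K ^ e) :
    ∃ N ≤ n * (2 * h), ∃ (φ : Fin N → Finset (Fin n) → (∀ i, ι i) → K)
      (ψ : Fin N → Finset (Fin n) → (∀ i, ι i) → κ → K),
      (∀ s I a a', (∀ i ∈ I, a i = a' i) → φ s I a = φ s I a') ∧
      (∀ s I a a', (∀ i ∉ I, a i = a' i) → ψ s I a = ψ s I a') ∧
      (∀ s a, φ s ∅ a = 0) ∧
      ∀ a c, t a c = ∑ s, ∑ I, φ s I a * ψ s I a c := by
  classical
  let Pw := MvPowerSeries (Σ i, ι i) K
  let J := nonMultilinearIdeal K ι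
  let B := Pw ⧸ J
  let cc : Pw →ₐ[K] K := { MvPowerSeries.constantCoeff with
    commutes' := fun r => by simp [Pw, MvPowerSeries.algebraMap_apply] }
  let ε : B →ₐ[K] K := Ideal.Quotient.liftₐ J cc fun f hf => constantCoeff_eq_zero_of_mem hf
  have hε : ∀ f : Pw, ε (Ideal.Quotient.mk J f) = MvPowerSeries.constantCoeff f := fun f => rfl
  have hunit : ∀ b, ε b ≠ 0 → IsUnit b := by
    intro b hb
    obtain ⟨f, rfl⟩ := Ideal.Quotient.mk_surjective b
    rw [hε] at hb
    exact (MvPowerSeries.isUnit_iff_constantCoeff.mpr (isUnit_iff_ne_zero.mpr hb)).map _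
  let F : κ → MvPolynomial (Σ i, ι i) K := fun c =>
    ∑ a, MvPolynomial.C (t a c) * ∏ i, MvPolynomial.X ⟨i, a i⟩
  have hF : ∀ c, (F c).totalDegree ≤ n + 1 := by
    intro c
    refine MvPolynomial.totalDegree_finsetSum_le fun a _ => ?_
    refine (MvPolynomial.totalDegree_mul _ _).trans ?_
    rw [MvPolynomial.totalDegree_C, zero_add]
    refine (MvPolynomial.totalDegree_finsetProd _ _).trans ?_
    simp [MvPolynomial.totalDegree_X]
  obtain ⟨z, -, S, hS, hεS, hmem⟩ := exists_few_generators (K := K) (B := B) ε hunit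
    (fun s : Σ i, ι i => (s.1 : ℕ)) (fun s => Ideal.Quotient.mk J (MvPowerSeries.X s))
    (fun s => by rw [hε]; simp) (fun s s' hs => by
      rw [← map_mul, Ideal.Quotient.eq_zero_iff_mem]
      exact X_mul_X_mem_nonMultilinearIdeal s s' (Fin.ext hs)) h n e (n + 1) κ _ F (by omega) hF
    (fun z hz c => by
      simpa [F] using (Finset.mem_filter.mp hz).2 c) hdense he hq
  have hjet : ∀ c, jet (fun s : Σ i, ι i => (s.1 : ℕ)) (fun s => Ideal.Quotient.mk J (MvPowerSeries.X s))
      n z (F c) = Ideal.Quotient.mk J (∑ a, algebraMap K _ (t a c) *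
      ∏ i, (algebraMap K Pw (z ⟨i, a i⟩) + MvPowerSeries.X ⟨i, a i⟩)) := by
    intro c
    simp only [jet, F, map_sum, map_mul, map_prod, MvPolynomial.aeval_X, map_add, Fin.is_lt, if_true]
    refine Finset.sum_congr rfl fun a _ => ?_
    congr 1
    rw [← MvPolynomial.algebraMap_eq, AlgHom.commutes]
    rfl
  choose r hr using fun c => Submodule.mem_span_finset.mp (hmem c)
  have hlift := Ideal.Quotient.mk_surjective (I := J)
  choose lift hlift using hlift
  let en := S.equivFin.symm
  refine ⟨S.card, hS, fun s I a => MvPowerSeries.coeff (blockExp I a) (lift (en s)),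
    fun s I a c => MvPowerSeries.coeff (blockExp Iᶜ a) (lift (r c (en s))), ?_, ?_, ?_, ?_⟩
  · intro s I a a' h
    simp only [blockExp_congr h]
  · intro s I a a' h
    funext c
    simp only [blockExp_congr (I := Iᶜ) (a := a) (a' := a') (fun i hi => h i (Finset.mem_compl.mp hi))]
  · intro s a
    have h0 : blockExp (∅ : Finset (Fin n)) a = 0 := by ext; simp [blockExp_apply]
    change MvPowerSeries.coeff (blockExp ∅ a) (lift (en s)) = 0
    rw [h0, MvPowerSeries.coeff_zero_eq_constantCoeff_apply, ← hε, hlift]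
    exact hεS _ (en s).2
  · intro a c
    have h1 := (hr c).2
    rw [hjet] at h1
    have h2 : Ideal.Quotient.mk J (∑ s, lift (r c (en s)) * lift (en s)) = ∑ b ∈ S, r c b • b := by
      rw [← Finset.sum_coe_sort S, ← en.sum_comp]
      simp only [map_sum, map_mul, hlift, smul_eq_mul]
    rw [← h2, Ideal.Quotient.eq] at h1
    have h3 := coeff_blockExp_eq_zero h1 Finset.univ a
    rw [map_sub, coeff_shifted_tensor, sub_eq_zero] at h3
    rw [← h3, map_sum]
    refine Finset.sum_congr rfl fun s _ => ?_
    rw [mul_comm, coeff_mul_blockExp]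

theorem ravg_equiv {α β : Type*} [Fintype α] [Fintype β] (e : α ≃ β) (f : β → ℝ) :
    ravg (fun x => f (e x)) = ravg f := by
  unfold ravg
  rw [e.sum_comp, Fintype.card_congr e]

theorem ravg_prod {α β : Type*} [Fintype α] [Fintype β] (f : α × β → ℝ) :
    ravg f = ravg fun x => ravg fun y => f (x, y) := by
  unfold ravg
  rw [Fintype.sum_prod_type, Fintype.card_prod, ← Finset.sum_div, div_div]
  push_cast
  rw [mul_comm (Fintype.card α : ℝ)]

theorem ravg_comm {α β : Type*} [Fintype α] [Fintype β] (f : α → β → ℝ) :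
    (ravg fun x => ravg fun y => f x y) = ravg fun y => ravg fun x => f x y := by
  rw [← ravg_prod fun z : α × β => f z.1 z.2, ← ravg_prod fun z : β × α => f z.2 z.1,
    ← ravg_equiv (Equiv.prodComm α β)]
  rfl

theorem ravg_mono {α : Type*} [Fintype α] {f g : α → ℝ} (h : ∀ x, f x ≤ g x) : ravg f ≤ ravg g :=
  div_le_div_of_nonneg_right (Finset.sum_le_sum fun x _ => h x) (Nat.cast_nonneg _)

theorem ravg_nonneg {α : Type*} [Fintype α] {f : α → ℝ} (h : ∀ x, 0 ≤ f x) : 0 ≤ ravg f :=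
  div_nonneg (Finset.sum_nonneg fun x _ => h x) (Nat.cast_nonneg _)

theorem ravg_pow_le {α : Type*} [Fintype α] [Nonempty α] {f : α → ℝ} (h : ∀ x, 0 ≤ f x) (m : ℕ) :
    ravg f ^ m ≤ ravg fun x => f x ^ m := by
  have hc : (Fintype.card α : ℝ) ≠ 0 := Nat.cast_ne_zero.mpr Fintype.card_ne_zero
  have h1 := Real.pow_arith_mean_le_arith_mean_pow (Finset.univ : Finset α)
    (fun _ => (Fintype.card α : ℝ)⁻¹) f (fun _ _ => by positivity) (by simp [hc]) (fun x _ => h x) m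
  simpa only [ravg, ← Finset.mul_sum, div_eq_inv_mul] using h1

theorem ravg_prod_pow {α : Type*} [Fintype α] (f : α → ℝ) (l : ℕ) :
    (ravg fun y : Fin l → α => ∏ v, f (y v)) = ravg f ^ l := by
  unfold ravg
  rw [div_pow, Fintype.sum_pow, Fintype.card_fun, Fintype.card_fin]
  push_cast
  rfl

/-- A Sidorenko-type inequality for blow-ups of a partite hypergraph. -/
theorem ravg_pow_le_blowup (l : ℕ) : ∀ (n : ℕ) (X : Fin n → Type) [∀ i, Fintype (X i)]
    [∀ i, Nonempty (X i)] (f : (∀ i, X i) → ℝ), (∀ x, 0 ≤ f x) →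
    ravg f ^ l ^ n ≤
      ravg fun y : ∀ i, Fin l → X i => ∏ u : Fin n → Fin l, f fun i => y i (u i)
  | 0, X, _, _, f, _ => by
    simp only [ravg, pow_zero, pow_one, Finset.univ_unique, Finset.prod_singleton,
      Finset.sum_singleton, Fintype.card_unique]
    exact le_of_eq (by congr 2; exact Subsingleton.elim _ _)
  | n + 1, X, _, _, f, hf => by
    have e1 : ravg f = ravg fun x' : ∀ i : Fin n, X i.succ => ravg fun x0 => f (Fin.cons x0 x') := by
      rw [ravg_comm, ← ravg_equiv (Fin.consEquiv X), ravg_prod]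
      rfl
    have e2 : (ravg fun y : ∀ i, Fin l → X i => ∏ u : Fin (n + 1) → Fin l, f fun i => y i (u i)) =
        ravg fun y0 : Fin l → X 0 => ravg fun y' : ∀ i : Fin n, Fin l → X i.succ =>
          ∏ u : Fin n → Fin l, ∏ v, f (Fin.cons (y0 v) fun i => y' i (u i)) := by
      rw [← ravg_equiv (Fin.consEquiv fun i => Fin l → X i), ravg_prod]
      refine congrArg ravg (funext fun y0 => congrArg ravg (funext fun y' => ?_))
      rw [← (Fin.consEquiv fun _ : Fin (n + 1) => Fin l).prod_comp, Fintype.prod_prod_type,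
        Finset.prod_comm]
      refine Finset.prod_congr rfl fun u _ => Finset.prod_congr rfl fun v _ => congrArg f ?_
      funext i
      refine Fin.cases ?_ (fun i => ?_) i <;> rfl
    rw [e2]
    calc ravg f ^ l ^ (n + 1) = (ravg f ^ l) ^ l ^ n := by rw [← pow_mul, pow_succ']
      _ ≤ (ravg fun y0 : Fin l → X 0 => ravg fun x' : ∀ i : Fin n, X i.succ =>
          ∏ v, f (Fin.cons (y0 v) x')) ^ l ^ n := by
        refine pow_le_pow_left₀ (pow_nonneg (ravg_nonneg hf) _) ?_ _
        rw [ravg_comm, e1]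
        refine (ravg_pow_le (fun x' => ravg_nonneg fun x0 => hf _) l).trans (le_of_eq ?_)
        exact congrArg ravg (funext fun x' =>
          (ravg_prod_pow (fun x0 => f (Fin.cons x0 x' : ∀ i, X i)) l).symm)
      _ ≤ ravg fun y0 : Fin l → X 0 => (ravg fun x' : ∀ i : Fin n, X i.succ =>
          ∏ v, f (Fin.cons (y0 v) x')) ^ l ^ n :=
        ravg_pow_le (fun y0 => ravg_nonneg fun x' => Finset.prod_nonneg fun v _ => hf _) _
      _ ≤ _ := ravg_mono fun y0 => ravg_pow_le_blowup l n (fun i => X i.succ)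
          (fun x' => ∏ v, f (Fin.cons (y0 v) x')) fun x' => Finset.prod_nonneg fun v _ => hf _

theorem card_blowup_le {n l : ℕ} (X : Fin n → Type) [∀ i, Fintype (X i)] [∀ i, Nonempty (X i)]
    (A : Finset (∀ i, X i)) (P : ℕ) (hA : Fintype.card (∀ i, X i) ≤ A.card * P) :
    Fintype.card (∀ i, Fin l → X i) ≤ Nat.card {y : ∀ i, Fin l → X i //
      ∀ u : Fin n → Fin l, (fun i => y i (u i)) ∈ A} * P ^ l ^ n := by
  classical
  have h := ravg_pow_le_blowup l n X (fun x => if x ∈ A then 1 else 0) fun x => by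
    split_ifs <;> norm_num
  have h1 : (ravg fun x => if x ∈ A then (1 : ℝ) else 0) = A.card / Fintype.card (∀ i, X i) := by
    simp [ravg]
  have h2 : (ravg fun y : ∀ i, Fin l → X i => ∏ u : Fin n → Fin l,
      if (fun i => y i (u i)) ∈ A then (1 : ℝ) else 0) = Nat.card {y : ∀ i, Fin l → X i //
      ∀ u : Fin n → Fin l, (fun i => y i (u i)) ∈ A} / Fintype.card (∀ i, Fin l → X i) := by
    simp only [ravg, Finset.prod_ite_zero, Finset.prod_const_one, Finset.mem_univ, true_imp_iff]
    rw [Finset.sum_boole, Nat.card_eq_fintype_card, Fintype.card_subtype]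
  rw [h1, h2] at h
  have hN : (0 : ℝ) < Fintype.card (∀ i, X i) := Nat.cast_pos.mpr Fintype.card_pos
  have hN' : (0 : ℝ) < Fintype.card (∀ i, Fin l → X i) := Nat.cast_pos.mpr Fintype.card_pos
  have hA' : (Fintype.card (∀ i, X i) : ℝ) ≤ A.card * P := by exact_mod_cast hA
  have h3 : (1 : ℝ) ≤ (A.card / Fintype.card (∀ i, X i)) ^ l ^ n * P ^ l ^ n := by
    rw [← mul_pow]
    refine one_le_pow₀ ?_
    rw [div_mul_eq_mul_div, one_le_div hN]
    exact hA'
  have h4 := h3.trans (mul_le_mul_of_nonneg_right h (by positivity))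
  rw [div_mul_eq_mul_div, one_le_div hN'] at h4
  exact_mod_cast h4

theorem exists_linear_functional_one (p : ℕ) [Fact p.Prime] {K : Type} [Field K]
    [Algebra (ZMod p) K] {l : ℕ} (b : Module.Basis (Fin l) (ZMod p) K) :
    ∃ lam : K →ₗ[ZMod p] ZMod p, lam 1 = 1 := by
  have : b.repr 1 ≠ 0 := by
    rw [Ne, map_eq_zero_iff _ b.repr.injective]; exact one_ne_zero
  obtain ⟨u, hu⟩ := Finsupp.ne_iff.mp this
  exact ⟨(b.repr 1 u)⁻¹ • b.coord u, by simpa using inv_mul_cancel₀ hu⟩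

/-- Zero density of a tensor system passes to an extension field. -/
theorem card_zeros_extension_le (p : ℕ) [Fact p.Prime] {K : Type} [Field K] [Fintype K]
    [DecidableEq K] [Algebra (ZMod p) K] {l : ℕ} (b : Module.Basis (Fin l) (ZMod p) K) {n : ℕ}
    {ι : Fin n → Type} [∀ i, Fintype (ι i)] [∀ i, DecidableEq (ι i)] {κ : Type} [Fintype κ]
    (t : (∀ i, ι i) → κ → ZMod p) (P : ℕ)
    (ht : Fintype.card (∀ i, ι i → ZMod p) ≤
      ({x | ∀ c, ∑ a, t a c * ∏ i, x i (a i) = 0} : Finset (∀ i, ι i → ZMod p)).card * P) :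
    Fintype.card K ^ Fintype.card (Σ i, ι i) ≤
      ({z | ∀ c, ∑ a, algebraMap (ZMod p) K (t a c) * ∏ i, z ⟨i, a i⟩ = 0} :
        Finset ((Σ i, ι i) → K)).card * P ^ l ^ n := by
  have h := card_blowup_le (l := l) _ _ P ht
  let E : (∀ i, Fin l → ι i → ZMod p) → (Σ i, ι i) → K := fun y s =>
    ∑ v, y s.1 v s.2 • b v
  have hE : Function.Injective E := by
    intro y y' hyy
    funext i v a
    have h1 : ∀ y : ∀ i, Fin l → ι i → ZMod p, E y ⟨i, a⟩ = b.equivFun.symm (fun v => y i v a) :=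
      fun y => (b.equivFun_symm_apply _).symm
    have h2 := congrFun hyy ⟨i, a⟩
    rw [h1, h1] at h2
    exact congrFun (b.equivFun.symm.injective h2) v
  have hcardK : Fintype.card K = p ^ l := by
    rw [Module.card_eq_pow_finrank (K := ZMod p), ZMod.card, Module.finrank_eq_card_basis b,
      Fintype.card_fin]
  have hcard : Fintype.card K ^ Fintype.card (Σ i, ι i) =
      Fintype.card (∀ i, Fin l → ι i → ZMod p) := by
    rw [hcardK, Fintype.card_sigma]
    simp only [Fintype.card_pi, ZMod.card, Finset.prod_const, Finset.card_univ, Fintype.card_fin]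
    simp only [← pow_mul, Finset.prod_pow_eq_pow_sum, Finset.mul_sum]
    simp only [mul_comm]
  rw [hcard]
  refine h.trans (Nat.mul_le_mul_right _ ?_)
  rw [Nat.card_eq_fintype_card, Fintype.card_subtype]
  refine Finset.card_le_card_of_injOn E ?_ hE.injOn
  intro y hy
  simp only [Finset.coe_filter, Finset.mem_univ, true_and, Finset.mem_filter, Set.mem_ofPred_eq] at hy ⊢
  intro c
  have h3 : ∀ a : ∀ i, ι i, ∏ i, E y ⟨i, a i⟩ =
      ∑ u : Fin n → Fin l, algebraMap (ZMod p) K (∏ i, y i (u i) (a i)) * ∏ i, b (u i) := by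
    intro a
    simp only [E]
    rw [Finset.prod_univ_sum, Fintype.piFinset_univ]
    refine Finset.sum_congr rfl fun u _ => ?_
    simp only [Algebra.smul_def, Finset.prod_mul_distrib, map_prod]
  simp only [h3, Finset.mul_sum]
  rw [Finset.sum_comm]
  refine Finset.sum_eq_zero fun u _ => ?_
  have := congrArg (algebraMap (ZMod p) K) (hy u c)
  simp only [map_sum, map_mul, map_zero] at this
  simp only [← mul_assoc, ← Finset.sum_mul]
  rw [this, zero_mul]

theorem tensor_decomposition_of_extension (p : ℕ) [Fact p.Prime] {K : Type} [Field K] [Fintype K]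
    [DecidableEq K] [Algebra (ZMod p) K] {l : ℕ} (b : Module.Basis (Fin l) (ZMod p) K)
    (hcardK : Fintype.card K = p ^ l) {n : ℕ}
    {ι : Fin n → Type} [∀ i, DecidableEq (ι i)] [∀ i, Fintype (ι i)] {κ : Type} [Fintype κ]
    (t : (∀ i, ι i) → κ → ZMod p) {r h : ℕ} (hl : l ≠ 0) (he : r * l ^ n + n + 1 ≤ h)
    (hq : ((n + 1) * (2 * h + 1) ^ n * (2 * h) + 2) ^ 2 ≤ p ^ l)
    (hdense : Fintype.card (∀ i, ι i → ZMod p) ≤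
      ({x | ∀ c, ∑ a, t a c * ∏ i, x i (a i) = 0} : Finset (∀ i, ι i → ZMod p)).card * p ^ r) :
    ∃ N ≤ n * (2 * h) * l, ∃ (φ : Fin N → Finset (Fin n) → (∀ i, ι i) → ZMod p)
      (ψ : Fin N → Finset (Fin n) → (∀ i, ι i) → κ → ZMod p),
      (∀ s I a a', (∀ i ∈ I, a i = a' i) → φ s I a = φ s I a') ∧
      (∀ s I a a', (∀ i ∉ I, a i = a' i) → ψ s I a = ψ s I a') ∧
      (∀ s a, φ s ∅ a = 0) ∧
      ∀ a c, t a c = ∑ s, ∑ I, φ s I a * ψ s I a c := by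
  classical
  have hd := card_zeros_extension_le p b t _ hdense
  have hpq : (p ^ r) ^ l ^ n ≤ Fintype.card K ^ (r * l ^ n) := by
    rw [hcardK, pow_mul (p ^ l)]
    refine Nat.pow_le_pow_left (Nat.pow_le_pow_left ?_ r) _
    exact Nat.le_self_pow hl p
  obtain ⟨N, hN, φ, ψ, hφ, hψ, hφ0, hdec⟩ := tensor_decomposition_of_dense_zeros (K := K)
    (fun a c => algebraMap (ZMod p) K (t a c)) he (hq.trans hcardK.ge)
    (hd.trans (Nat.mul_le_mul_left _ hpq))
  obtain ⟨lam, hlam⟩ := exists_linear_functional_one p b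
  let en : Fin (N * l) ≃ Fin N × Fin l := finProdFinEquiv.symm
  refine ⟨N * l, Nat.mul_le_mul_right _ hN, fun s I a => b.repr (φ (en s).1 I a) (en s).2,
    fun s I a c => lam (b (en s).2 * ψ (en s).1 I a c), ?_, ?_, ?_, ?_⟩
  · intro s I a a' h
    simp only [hφ _ I a a' h]
  · intro s I a a' h
    simp only [hψ _ I a a' h]
  · intro s a
    simp [hφ0]
  · intro a c
    have h1 : ∀ x y : K, lam (x * y) = ∑ u, b.repr x u * lam (b u * y) := by
      intro x y
      conv_lhs => rw [← b.sum_repr x, Finset.sum_mul, map_sum]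
      simp
    have h2 := congrArg lam (hdec a c)
    rw [Algebra.algebraMap_eq_smul_one, map_smul, hlam, smul_eq_mul, mul_one] at h2
    rw [h2, ← en.symm.sum_comp, Fintype.sum_prod_type]
    simp only [map_sum, Equiv.apply_symm_apply]
    refine Finset.sum_congr rfl fun s _ => ?_
    rw [Finset.sum_comm]
    exact Finset.sum_congr rfl fun I _ => h1 _ _

theorem tensor_decomposition (p : ℕ) [Fact p.Prime] {n : ℕ}
    {ι : Fin n → Type} [∀ i, DecidableEq (ι i)] [∀ i, Fintype (ι i)] {κ : Type} [Fintype κ]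
    (t : (∀ i, ι i) → κ → ZMod p) {r l h : ℕ} (hl : l ≠ 0) (he : r * l ^ n + n + 1 ≤ h)
    (hq : ((n + 1) * (2 * h + 1) ^ n * (2 * h) + 2) ^ 2 ≤ p ^ l)
    (hdense : Fintype.card (∀ i, ι i → ZMod p) ≤
      ({x | ∀ c, ∑ a, t a c * ∏ i, x i (a i) = 0} : Finset (∀ i, ι i → ZMod p)).card * p ^ r) :
    ∃ N ≤ n * (2 * h) * l, ∃ (φ : Fin N → Finset (Fin n) → (∀ i, ι i) → ZMod p)
      (ψ : Fin N → Finset (Fin n) → (∀ i, ι i) → κ → ZMod p),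
      (∀ s I a a', (∀ i ∈ I, a i = a' i) → φ s I a = φ s I a') ∧
      (∀ s I a a', (∀ i ∉ I, a i = a' i) → ψ s I a = ψ s I a') ∧
      (∀ s a, φ s ∅ a = 0) ∧
      ∀ a c, t a c = ∑ s, ∑ I, φ s I a * ψ s I a c := by
  classical
  let _ : Fintype (GaloisField p l) := Fintype.ofFinite _
  have hcardK : Fintype.card (GaloisField p l) = p ^ l := by
    rw [← Nat.card_eq_fintype_card]; exact GaloisField.card p l hl
  exact tensor_decomposition_of_extension p
    (Module.finBasisOfFinrankEq (ZMod p) (GaloisField p l) (GaloisField.finrank p hl)) hcardK t hl he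
    hq hdense

theorem multilinear_expand {p : ℕ} {J : Type*} [Fintype J] [DecidableEq J] {G : J → Type*}
    [∀ j, AddCommGroup (G j)] [∀ j, Module (ZMod p) (G j)] {M : Type*} [AddCommGroup M]
    [Module (ZMod p) M] {ι : J → Type*} [∀ j, Fintype (ι j)]
    (b : ∀ j, Module.Basis (ι j) (ZMod p) (G j)) (f : MultilinearMap (ZMod p) G M)
    (x : ∀ j, G j) :
    f x = ∑ a : ∀ j, ι j, (∏ j, (b j).repr (x j) (a j)) • f fun j => b j (a j) := by
  conv_lhs => rw [show x = fun j => ∑ c, (b j).repr (x j) c • b j c from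
    funext fun j => ((b j).sum_repr (x j)).symm]
  rw [MultilinearMap.map_sum]
  exact Finset.sum_congr rfl fun a _ => MultilinearMap.map_smul_univ _ _ _

/-- The multilinear form with prescribed values on a product of bases. -/
noncomputable def formOfCoords {p : ℕ} {J : Type*} [Fintype J] [DecidableEq J] {G : J → Type*}
    [∀ j, AddCommGroup (G j)] [∀ j, Module (ZMod p) (G j)] {ι : J → Type*} [∀ j, Fintype (ι j)]
    (b : ∀ j, Module.Basis (ι j) (ZMod p) (G j)) (φ : (∀ j, ι j) → ZMod p) :
    MultilinearMap (ZMod p) G (ZMod p) :=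
  ∑ a, φ a • (MultilinearMap.mkPiAlgebra (ZMod p) J (ZMod p)).compLinearMap
    fun j => (b j).coord (a j)

theorem formOfCoords_apply {p : ℕ} {J : Type*} [Fintype J] [DecidableEq J] {G : J → Type*}
    [∀ j, AddCommGroup (G j)] [∀ j, Module (ZMod p) (G j)] {ι : J → Type*} [∀ j, Fintype (ι j)]
    (b : ∀ j, Module.Basis (ι j) (ZMod p) (G j)) (φ : (∀ j, ι j) → ZMod p) (x : ∀ j, G j) :
    formOfCoords b φ x = ∑ a, φ a * ∏ j, (b j).repr (x j) (a j) := by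
  simp [formOfCoords]

theorem hasPrankDecomp_of_coords {p k : ℕ} {G : Fin k → Type} [∀ i, AddCommGroup (G i)]
    [∀ i, Module (ZMod p) (G i)] {ι : Fin k → Type} [∀ j, Fintype (ι j)] [∀ j, Nonempty (ι j)]
    (b : ∀ j, Module.Basis (ι j) (ZMod p) (G j)) (α : MultilinearMap (ZMod p) G (ZMod p))
    {T : Type} [Fintype T] (I : T → Finset (Fin k)) (φ ψ : T → (∀ j, ι j) → ZMod p)
    (hI : ∀ t, (I t).Nonempty ∧ I t ≠ Finset.univ)
    (hφ : ∀ t a a', (∀ j ∈ I t, a j = a' j) → φ t a = φ t a')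
    (hψ : ∀ t a a', (∀ j ∉ I t, a j = a' j) → ψ t a = ψ t a')
    (h : ∀ a, α (fun j => b j (a j)) = ∑ t, φ t a * ψ t a) :
    HasPrankDecomp p G α (Fintype.card T) := by
  classical
  let d : ∀ j, ι j := fun j => Classical.arbitrary _
  let β : ∀ t, MultilinearMap (ZMod p) (fun j : {j : Fin k // j ∈ I t} => G j.1) (ZMod p) :=
    fun t => formOfCoords (fun j : {j : Fin k // j ∈ I t} => b j.1)
      fun a => φ t fun j => if hj : j ∈ I t then a ⟨j, hj⟩ else d j
  let γ : ∀ t, MultilinearMap (ZMod p) (fun j : {j : Fin k // j ∉ I t} => G j.1) (ZMod p) :=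
    fun t => formOfCoords (fun j : {j : Fin k // j ∉ I t} => b j.1)
      fun a => ψ t fun j => if hj : j ∉ I t then a ⟨j, hj⟩ else d j
  have key : ∀ x, α x = ∑ t, β t (fun j => x j.1) * γ t (fun j => x j.1) := by
    intro x
    rw [multilinear_expand b α x]
    simp only [h, Finset.smul_sum]
    rw [Finset.sum_comm]
    refine Finset.sum_congr rfl fun t _ => ?_
    rw [formOfCoords_apply, formOfCoords_apply, Fintype.sum_mul_sum, ← Fintype.sum_prod_type',
      ← (Equiv.piEquivPiSubtypeProd (fun j => j ∈ I t) ι).sum_comp]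
    refine Finset.sum_congr rfl fun a _ => ?_
    rw [← Fintype.prod_subtype_mul_prod_subtype (fun j => j ∈ I t)
      (fun j => (b j).repr (x j) (a j))]
    simp only [Equiv.piEquivPiSubtypeProd_apply, smul_eq_mul]
    rw [hφ t (fun j => if _ : j ∈ I t then a j else d j) a fun j hj => by simp [hj],
      hψ t (fun j => if _ : j ∉ I t then a j else d j) a fun j hj => by simp [hj]]
    rw [mul_mul_mul_comm, mul_comm _ (φ t a), mul_comm _ (ψ t a)]
    congr!
  let e := Fintype.equivFin T
  refine ⟨fun i => I (e.symm i), fun i => β (e.symm i), fun i => γ (e.symm i),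
    fun i => hI _, fun x => ?_⟩
  rw [key x, ← e.symm.sum_comp]

theorem hasPrankDecomp_zero (p : ℕ) {k : ℕ} (G : Fin k → Type) [∀ i, AddCommGroup (G i)]
    [∀ i, Module (ZMod p) (G i)] : HasPrankDecomp p G 0 0 :=
  ⟨fun i => i.elim0, fun i => i.elim0, fun i => i.elim0, fun i => i.elim0, fun x => by simp⟩

theorem hasPrankDecomp_of_dense_zeros (p : ℕ) [Fact p.Prime] {n : ℕ} {G : Fin (n + 1) → Type}
    [∀ i, AddCommGroup (G i)] [∀ i, Module (ZMod p) (G i)] [∀ i, Fintype (G i)]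
    (α : MultilinearMap (ZMod p) G (ZMod p)) {r l h : ℕ} (hl : l ≠ 0)
    (he : r * l ^ n + n + 1 ≤ h) (hq : ((n + 1) * (2 * h + 1) ^ n * (2 * h) + 2) ^ 2 ≤ p ^ l)
    (hdense : Nat.card (∀ i : Fin n, G i.castSucc) ≤
      Nat.card {x : ∀ i : Fin n, G i.castSucc // ∀ y, α (Fin.snoc x y) = 0} * p ^ r) :
    ∃ m ≤ n * (2 * h) * l * 2 ^ n, HasPrankDecomp p G α m := by
  classical
  by_cases hα : α = 0
  · exact ⟨0, Nat.zero_le _, hα ▸ hasPrankDecomp_zero p G⟩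
  let b : ∀ j, Module.Basis (Fin (Module.finrank (ZMod p) (G j))) (ZMod p) (G j) :=
    fun j => Module.finBasis (ZMod p) (G j)
  have hne : ∀ j, Nonempty (Fin (Module.finrank (ZMod p) (G j))) := by
    intro j
    by_contra hj
    rw [not_nonempty_iff] at hj
    have := (b j).repr.injective.subsingleton
    refine hα (MultilinearMap.ext fun x => ?_)
    exact α.map_coord_zero j (Subsingleton.elim _ _)
  let t : (∀ i : Fin n, Fin (Module.finrank (ZMod p) (G i.castSucc))) →
      Fin (Module.finrank (ZMod p) (G (Fin.last n))) → ZMod p :=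
    fun a c => α.curryRight (fun i => b i.castSucc (a i)) (b (Fin.last n) c)
  have hexp : ∀ (x : ∀ i : Fin n, G i.castSucc) c,
      ∑ a, t a c * ∏ i, (b i.castSucc).equivFun (x i) (a i) =
        α (Fin.snoc x (b (Fin.last n) c)) := by
    intro x c
    rw [← MultilinearMap.curryRight_apply,
      multilinear_expand (fun i : Fin n => b i.castSucc) α.curryRight x, LinearMap.sum_apply]
    refine Finset.sum_congr rfl fun a _ => ?_
    rw [LinearMap.smul_apply, smul_eq_mul, mul_comm]
    rfl
  let E : (∀ i : Fin n, G i.castSucc) ≃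
      (∀ i : Fin n, Fin (Module.finrank (ZMod p) (G i.castSucc)) → ZMod p) :=
    Equiv.piCongrRight fun i => (b i.castSucc).equivFun.toEquiv
  have hdense' : Fintype.card (∀ i : Fin n, Fin (Module.finrank (ZMod p) (G i.castSucc)) → ZMod p) ≤
      ({x | ∀ c, ∑ a, t a c * ∏ i, x i (a i) = 0} :
        Finset (∀ i : Fin n, Fin (Module.finrank (ZMod p) (G i.castSucc)) → ZMod p)).card *
        p ^ r := by
    rw [← Fintype.card_congr E, ← Nat.card_eq_fintype_card]
    refine hdense.trans (Nat.mul_le_mul_right _ ?_)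
    rw [← Fintype.card_subtype, ← Nat.card_eq_fintype_card]
    refine Nat.card_le_card_of_injective
      (fun x => ⟨E x.1, fun c => (hexp x.1 c).trans (x.2 _)⟩) fun x y hxy => ?_
    exact Subtype.ext (E.injective (congrArg Subtype.val hxy))
  obtain ⟨N, hN, φ, ψ, hφ, hψ, h0, hsum⟩ := tensor_decomposition p t hl he hq (by convert hdense')
  refine ⟨Fintype.card (Fin N × {I : Finset (Fin n) // I.Nonempty}), ?_,
    hasPrankDecomp_of_coords b α (fun s => s.2.1.map Fin.castSuccEmb)
      (fun s a => φ s.1 s.2.1 fun i => a i.castSucc)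
      (fun s a => ψ s.1 s.2.1 (fun i => a i.castSucc) (a (Fin.last n)))
      (fun s => ⟨s.2.2.map, fun hs => ?_⟩) (fun s a a' haa => ?_) (fun s a a' haa => ?_)
      fun a => ?_⟩
  · rw [Fintype.card_prod, Fintype.card_fin]
    refine Nat.mul_le_mul hN ((Fintype.card_subtype_le _).trans ?_)
    simp
  · have := hs ▸ Finset.mem_univ (Fin.last n)
    simp only [Finset.mem_map, Fin.castSuccEmb_apply] at this
    obtain ⟨i, -, hi⟩ := this
    exact (Fin.castSucc_lt_last i).ne hi
  · exact hφ _ _ _ _ fun i hi => haa _ (Finset.mem_map_of_mem Fin.castSuccEmb hi)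
  · rw [haa (Fin.last n) fun hs => by
      simp only [Finset.mem_map, Fin.castSuccEmb_apply] at hs
      obtain ⟨i, -, hi⟩ := hs
      exact (Fin.castSucc_lt_last i).ne hi]
    refine congrFun (hψ _ _ _ _ fun i hi => haa _ fun hs => hi ?_) _
    simpa using hs
  · have h1 : α (fun j => b j (a j)) = t (fun i => a i.castSucc) (a (Fin.last n)) := by
      refine congrArg α (funext fun j => ?_)
      refine Fin.lastCases ?_ (fun i => ?_) j <;> simp
    rw [h1, hsum, Fintype.sum_prod_type]
    refine Finset.sum_congr rfl fun s _ => ?_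
    refine (Finset.sum_filter_of_ne fun I _ hI => ?_).symm.trans
      (Finset.sum_subtype {I : Finset (Fin n) | I.Nonempty} (by simp) _)
    rw [Finset.nonempty_iff_ne_empty]
    rintro rfl
    exact hI (by rw [h0, zero_mul])

theorem chi_eq_stdAddChar (p : ℕ) [NeZero p] (t : ZMod p) : chi p t = ZMod.stdAddChar t := by
  rw [ZMod.stdAddChar_apply, ZMod.toCircle_apply, chi, mul_div_assoc]

theorem conjIter_mul (m : ℕ) (z w : ℂ) : conjIter m (z * w) = conjIter m z * conjIter m w := by
  induction m with
  | zero => rfl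
  | succ m ih =>
    simp only [conjIter, Function.iterate_succ_apply'] at ih ⊢
    rw [ih, map_mul]

theorem norm_conjIter (m : ℕ) (z : ℂ) : ‖conjIter m z‖ = ‖z‖ := by
  induction m with
  | zero => rfl
  | succ m ih =>
    simp only [conjIter, Function.iterate_succ_apply'] at ih ⊢
    rw [RCLike.norm_conj, ih]

theorem conjIter_stdAddChar (p : ℕ) [NeZero p] (m : ℕ) (t : ZMod p) :
    conjIter m (ZMod.stdAddChar t) = ZMod.stdAddChar ((-1) ^ m * t) := by
  induction m with
  | zero => simp [conjIter]
  | succ m ih =>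
    simp only [conjIter, Function.iterate_succ_apply'] at ih ⊢
    rw [ih, ← AddChar.map_neg_eq_conj, pow_succ', neg_one_mul, neg_mul]

theorem multilinear_map_sub {p k : ℕ} {G : Fin k → Type} [∀ i, AddCommGroup (G i)]
    [∀ i, Module (ZMod p) (G i)] (μ : MultilinearMap (ZMod p) G (ZMod p)) (x y : ∀ i, G i) :
    μ (y - x) = ∑ I : Finset (Fin k), (-1) ^ I.card * μ fun i => if i ∈ I then x i else y i := by
  rw [sub_eq_neg_add, MultilinearMap.map_add_univ]
  refine Finset.sum_congr rfl fun I _ => ?_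
  have h := μ.map_piecewise_smul (fun _ => -1) (I.piecewise x y) I
  rw [Finset.prod_const, smul_eq_mul] at h
  rw [show (fun i => if i ∈ I then x i else y i) = I.piecewise x y from rfl, ← h]
  congr 1
  funext i
  by_cases hi : i ∈ I <;> simp [hi]

theorem addChar_map_sum {A M J : Type*} [AddCommMonoid A] [CommMonoid M] (ψ : AddChar A M)
    (s : Finset J) (u : J → A) : ψ (∑ j ∈ s, u j) = ∏ j ∈ s, ψ (u j) := by
  classical
  induction s using Finset.induction_on with
  | empty => simp
  | insert j s hj ih =>
    rw [Finset.sum_insert hj, Finset.prod_insert hj, AddChar.map_add_eq_mul, ih]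

theorem exists_boxPow_eq (p : ℕ) [NeZero p] {k : ℕ} {G : Fin k → Type} [∀ i, AddCommGroup (G i)]
    [∀ i, Module (ZMod p) (G i)] [∀ i, Fintype (G i)] (f : (∀ i, G i) → ℂ) (hf : ∀ x, ‖f x‖ ≤ 1) :
    ∃ F : (∀ i, G i) × (∀ i, G i) → ℂ, (∀ z, ‖F z‖ ≤ 1) ∧
      ∀ μ : MultilinearMap (ZMod p) G (ZMod p), boxPow (fun x => f x * chi p (μ x)) =
        cavg fun z => F z * ZMod.stdAddChar (μ (z.2 - z.1)) := by
  refine ⟨fun z => ∏ I : Finset (Fin k), conjIter I.card (f fun i => if i ∈ I then z.1 i else z.2 i),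
    fun z => ?_, fun μ => ?_⟩
  · rw [norm_prod]
    exact Finset.prod_le_one (fun _ _ => norm_nonneg _) fun I _ => by
      rw [norm_conjIter]; exact hf _
  · refine congrArg cavg (funext fun z => ?_)
    rw [multilinear_map_sub, addChar_map_sum, ← Finset.prod_mul_distrib]
    refine Finset.prod_congr rfl fun I _ => ?_
    rw [conjIter_mul, chi_eq_stdAddChar, conjIter_stdAddChar]

open Classical in
/-- The density of the zero set of a map on a finite type. -/
noncomputable def zeroDensity {X M : Type*} [Fintype X] [Zero M] (f : X → M) : ℝ :=
  ravg fun x => if f x = 0 then 1 else 0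

theorem zeroDensity_eq {X M : Type*} [Fintype X] [Zero M] (f : X → M) :
    zeroDensity f = Nat.card {x // f x = 0} / Nat.card X := by
  classical
  rw [zeroDensity, ravg, Finset.sum_boole, Nat.card_eq_fintype_card, Nat.card_eq_fintype_card,
    Fintype.card_subtype]

theorem zeroDensity_le_one {X M : Type*} [Fintype X] [Zero M] (f : X → M) :
    zeroDensity f ≤ 1 := by
  classical
  rw [zeroDensity, ravg, Finset.sum_boole]
  exact div_le_one_of_le₀ (Nat.cast_le.mpr (Finset.card_le_univ _)) (Nat.cast_nonneg _)

theorem cavg_stdAddChar (p : ℕ) [NeZero p] {n : ℕ} {G : Fin (n + 1) → Type}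
    [∀ i, AddCommGroup (G i)] [∀ i, Module (ZMod p) (G i)] [∀ i, Fintype (G i)]
    (α : MultilinearMap (ZMod p) G (ZMod p)) :
    (cavg fun z : (∀ i, G i) × (∀ i, G i) => (ZMod.stdAddChar (α (z.2 - z.1)) : ℂ)) =
      zeroDensity α.curryRight := by
  classical
  have hlin : ∀ L : G (Fin.last n) →ₗ[ZMod p] ZMod p,
      ∑ y, (ZMod.stdAddChar (L y) : ℂ) =
        if L = 0 then (Fintype.card (G (Fin.last n)) : ℂ) else 0 := by
    intro L
    have h := AddChar.sum_eq_ite ((ZMod.stdAddChar (N := p)).compAddMonoidHom L.toAddMonoidHom)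
    refine h.trans (if_congr ?_ rfl rfl)
    constructor
    · intro h0
      refine LinearMap.ext fun y => ZMod.injective_stdAddChar ?_
      simpa using DFunLike.congr_fun h0 y
    · rintro rfl
      ext y
      simp
  have hsum : ∑ w : ∀ i, G i, (ZMod.stdAddChar (α w) : ℂ) =
      Fintype.card (G (Fin.last n)) *
        ∑ x : ∀ i : Fin n, G i.castSucc, if α.curryRight x = 0 then (1 : ℂ) else 0 := by
    rw [← (Fin.snocEquiv G).sum_comp, Fintype.sum_prod_type, Finset.sum_comm, Finset.mul_sum]
    refine Finset.sum_congr rfl fun x _ => ?_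
    rw [mul_ite, mul_one, mul_zero, ← hlin]
    rfl
  have hcard : Fintype.card (∀ i, G i) =
      Fintype.card (G (Fin.last n)) * Fintype.card (∀ i : Fin n, G i.castSucc) := by
    rw [← Fintype.card_congr (Fin.snocEquiv G), Fintype.card_prod]
  have h2 : ∀ x : ∀ i, G i, ∑ y : ∀ i, G i, (ZMod.stdAddChar (α (y - x)) : ℂ) =
      ∑ w : ∀ i, G i, (ZMod.stdAddChar (α w) : ℂ) :=
    fun x => (Equiv.subRight x).sum_comp fun w => (ZMod.stdAddChar (α w) : ℂ)
  have hne : (Fintype.card (G (Fin.last n)) : ℂ) ≠ 0 := Nat.cast_ne_zero.mpr Fintype.card_ne_zero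
  have hne' : (Fintype.card (∀ i, G i) : ℂ) ≠ 0 := Nat.cast_ne_zero.mpr Fintype.card_ne_zero
  rw [cavg, Fintype.sum_prod_type]
  simp only [h2]
  rw [Finset.sum_const, Finset.card_univ, nsmul_eq_mul, Fintype.card_prod, Nat.cast_mul,
    mul_div_mul_left _ _ hne', hsum, hcard, Nat.cast_mul, mul_div_mul_left _ _ hne, zeroDensity,
    ravg]
  push_cast [apply_ite]
  rfl

theorem norm_cavg_sq_le {X : Type*} [Fintype X] (g : X → ℂ) :
    ‖cavg g‖ ^ 2 ≤ ravg fun x => ‖g x‖ ^ 2 := by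
  rcases isEmpty_or_nonempty X with hX | hX
  · simp [cavg, ravg]
  · calc ‖cavg g‖ ^ 2 ≤ (ravg fun x => ‖g x‖) ^ 2 := by
          refine pow_le_pow_left₀ (norm_nonneg _) ?_ 2
          rw [cavg, ravg, norm_div, Complex.norm_natCast]
          exact div_le_div_of_nonneg_right (norm_sum_le _ _) (Nat.cast_nonneg _)
      _ ≤ _ := ravg_pow_le (fun x => norm_nonneg _) 2

theorem sum_zeroDensity_ge (p : ℕ) [NeZero p] {n : ℕ} {G : Fin (n + 1) → Type}
    [∀ i, AddCommGroup (G i)] [∀ i, Module (ZMod p) (G i)] [∀ i, Fintype (G i)]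
    (f : (∀ i, G i) → ℂ) (hf : ∀ x, ‖f x‖ ≤ 1) {ε : ℝ} (hε : 0 < ε) {T : Type*} (s : Finset T)
    (μ : T → MultilinearMap (ZMod p) G (ZMod p)) (hμ : ∀ i, MemMLS p ε f (μ i)) :
    (s.card * ε ^ 2 ^ (n + 1)) ^ 2 ≤
      ∑ i ∈ s, ∑ j ∈ s, zeroDensity (μ i - μ j).curryRight := by
  obtain ⟨F, hF, hbox⟩ := exists_boxPow_eq p f hf
  set g : (∀ i, G i) × (∀ i, G i) → ℂ := fun z => ∑ i ∈ s, ZMod.stdAddChar (μ i (z.2 - z.1))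
  have h1 : ∑ i ∈ s, boxPow (fun x => f x * chi p (μ i x)) = cavg fun z => F z * g z := by
    simp only [hbox, cavg, g, Finset.mul_sum]
    rw [← Finset.sum_div, Finset.sum_comm]
  have h2 : s.card * ε ^ 2 ^ (n + 1) ≤ ‖cavg fun z => F z * g z‖ := by
    rw [← h1]
    refine le_trans ?_ (Complex.re_le_norm _)
    rw [Complex.re_sum, ← nsmul_eq_mul, ← Finset.sum_const]
    exact Finset.sum_le_sum fun i _ => hμ i
  have h3 : (ravg fun z => ‖g z‖ ^ 2) = ∑ i ∈ s, ∑ j ∈ s, zeroDensity (μ i - μ j).curryRight := by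
    have h4 : ∀ z, ((‖g z‖ ^ 2 : ℝ) : ℂ) =
        ∑ i ∈ s, ∑ j ∈ s, ZMod.stdAddChar ((μ i - μ j) (z.2 - z.1)) := by
      intro z
      rw [Complex.ofReal_pow, ← Complex.mul_conj', map_sum, Finset.sum_mul_sum]
      refine Finset.sum_congr rfl fun i _ => Finset.sum_congr rfl fun j _ => ?_
      rw [← AddChar.map_neg_eq_conj, ← AddChar.map_add_eq_mul, sub_apply,
        sub_eq_add_neg (μ i _)]
    apply Complex.ofReal_injective
    simp only [ravg, Complex.ofReal_div, Complex.ofReal_sum, h4, ← cavg_stdAddChar, cavg,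
      Complex.ofReal_natCast, ← Finset.sum_div]
    congr 1
    rw [Finset.sum_comm]
    exact Finset.sum_congr rfl fun i _ => Finset.sum_comm
  rw [← h3]
  refine (pow_le_pow_left₀ (by positivity) h2 2).trans ((norm_cavg_sq_le _).trans
    (ravg_mono fun z => pow_le_pow_left₀ (norm_nonneg _) ?_ 2))
  rw [norm_mul]
  exact mul_le_of_le_one_left (norm_nonneg _) (hF z)

theorem zeroDensity_linear_le (p : ℕ) [Fact p.Prime] {V M : Type*} [AddCommGroup V]
    [Module (ZMod p) V] [Fintype V] [AddCommGroup M] [Module (ZMod p) M] (L : V →ₗ[ZMod p] M)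
    (hL : L ≠ 0) : zeroDensity L ≤ 1 / p := by
  obtain ⟨v, hv⟩ : ∃ v, L v ≠ 0 := by
    by_contra! h
    exact hL (LinearMap.ext h)
  have hp : (0 : ℝ) < p := Nat.cast_pos.mpr (Fact.out : p.Prime).pos
  have hV : (0 : ℝ) < Nat.card V := Nat.cast_pos.mpr Nat.card_pos
  rw [zeroDensity_eq, div_le_div_iff₀ hV hp, one_mul]
  have h1 : Nat.card ({x // L x = 0} × ZMod p) ≤ Nat.card V := by
    refine Nat.card_le_card_of_injective (fun u => u.1.1 + u.2 • v) ?_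
    rintro ⟨⟨u, hu⟩, c⟩ ⟨⟨u', hu'⟩, c'⟩ h
    have h2 := congrArg L h
    simp only [map_add, map_smul, hu, hu', zero_add] at h2
    have hc : c = c' := by
      rw [← sub_eq_zero, ← sub_smul] at h2
      exact sub_eq_zero.mp ((smul_eq_zero.mp h2).resolve_right hv)
    subst hc
    simpa using h
  rw [Nat.card_prod, Nat.card_zmod] at h1
  exact_mod_cast h1

theorem zeroDensity_multilinear_le (p : ℕ) [Fact p.Prime] {M : Type*} [AddCommGroup M]
    [Module (ZMod p) M] : ∀ (n : ℕ) (G : Fin n → Type) [∀ i, AddCommGroup (G i)]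
    [∀ i, Module (ZMod p) (G i)] [∀ i, Fintype (G i)] (f : MultilinearMap (ZMod p) G M),
    f ≠ 0 → zeroDensity f ≤ 1 - (1 - 1 / (p : ℝ)) ^ n
  | 0, G, _, _, _, f, hf => by
    have h : ∀ x, f x ≠ 0 := fun x h0 => hf (MultilinearMap.ext fun y => by
      rw [Subsingleton.elim y x, h0]; rfl)
    simp [zeroDensity, ravg, h]
  | n + 1, G, _, _, _, f, hf => by
    classical
    have hp : (1 : ℝ) ≤ p := Nat.one_le_cast.mpr (Fact.out : p.Prime).pos
    have hq : 0 ≤ 1 - 1 / (p : ℝ) := by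
      rw [sub_nonneg, div_le_one (by linarith)]; exact hp
    have hL : f.curryLeft ≠ 0 := fun h => hf (MultilinearMap.ext fun x => by
      have := DFunLike.congr_fun (LinearMap.congr_fun h (x 0)) (Fin.tail x)
      rwa [MultilinearMap.curryLeft_apply, Fin.cons_self_tail] at this)
    have h1 : zeroDensity f = ravg fun x0 => zeroDensity (f.curryLeft x0) := by
      rw [zeroDensity, ← ravg_equiv (Fin.consEquiv G), ravg_prod]
      rfl
    have h2 : ∀ x0, zeroDensity (f.curryLeft x0) ≤ (1 - (1 - 1 / (p : ℝ)) ^ n) +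
        (1 - 1 / (p : ℝ)) ^ n * if f.curryLeft x0 = 0 then 1 else 0 := by
      intro x0
      split_ifs with h
      · rw [mul_one, sub_add_cancel]; exact zeroDensity_le_one _
      · rw [mul_zero, add_zero]; exact zeroDensity_multilinear_le p n _ _ h
    have h3 : (ravg fun x0 => (1 - (1 - 1 / (p : ℝ)) ^ n) +
        (1 - 1 / (p : ℝ)) ^ n * if f.curryLeft x0 = 0 then 1 else 0) =
        (1 - (1 - 1 / (p : ℝ)) ^ n) + (1 - 1 / (p : ℝ)) ^ n * zeroDensity f.curryLeft := by
      have hc : (Fintype.card (G 0) : ℝ) ≠ 0 := Nat.cast_ne_zero.mpr Fintype.card_ne_zero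
      rw [zeroDensity, ravg, ravg, Finset.sum_add_distrib, ← Finset.mul_sum, Finset.sum_const,
        Finset.card_univ, nsmul_eq_mul, add_div, mul_div_cancel_left₀ _ hc, mul_div_assoc]
      congr!
    rw [h1]
    refine (ravg_mono h2).trans ?_
    rw [h3]
    have h4 := mul_le_mul_of_nonneg_left (zeroDensity_linear_le p f.curryLeft hL) (pow_nonneg hq n)
    rw [pow_succ]
    linarith

theorem zeroDensity_curryRight_le (p : ℕ) [Fact p.Prime] {n : ℕ} {G : Fin (n + 1) → Type}
    [∀ i, AddCommGroup (G i)] [∀ i, Module (ZMod p) (G i)] [∀ i, Fintype (G i)]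
    (α : MultilinearMap (ZMod p) G (ZMod p)) (hα : α ≠ 0) :
    zeroDensity α.curryRight ≤ 1 - (1 - 1 / (p : ℝ)) ^ n :=
  zeroDensity_multilinear_le p n _ _ fun h => hα (MultilinearMap.ext fun x => by
    have := LinearMap.congr_fun (DFunLike.congr_fun h fun i : Fin n => x i.castSucc) (x (Fin.last n))
    rwa [MultilinearMap.curryRight_apply,
      show Fin.snoc (fun i : Fin n => x i.castSucc) (x (Fin.last n)) = x from Fin.snoc_init_self x] at this)

/-- A large family in the spectrum contains a pair whose difference is biased. -/
theorem exists_pair_biased (p : ℕ) [NeZero p] {n : ℕ} {G : Fin (n + 1) → Type}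
    [∀ i, AddCommGroup (G i)] [∀ i, Module (ZMod p) (G i)] [∀ i, Fintype (G i)]
    (f : (∀ i, G i) → ℂ) (hf : ∀ x, ‖f x‖ ≤ 1) {ε : ℝ} (hε : 0 < ε) {N : ℕ}
    (hN : 20 * (ε ^ 2 ^ (n + 2))⁻¹ ≤ (N : ℝ))
    (μ : Fin N → MultilinearMap (ZMod p) G (ZMod p)) (hμ : ∀ i, MemMLS p ε f (μ i)) :
    ∃ i j, i ≠ j ∧ ε ^ 2 ^ (n + 2) / 2 ≤ zeroDensity (μ i - μ j).curryRight ∧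
      4 * ε ^ 2 ^ (n + 2) - 3 ≤ zeroDensity (μ i - μ j).curryRight := by
  classical
  set δ := ε ^ 2 ^ (n + 2) with hδ
  have hδ0 : 0 < δ := by positivity
  have hN0 : (0 : ℝ) < N := lt_of_lt_of_le (by positivity) hN
  have hsq : ∀ c : ℝ, (c * ε ^ 2 ^ (n + 1)) ^ 2 = c ^ 2 * δ := by
    intro c
    rw [mul_pow, ← pow_mul, ← pow_succ]
  have hNδ : 20 ≤ N * δ := by
    rwa [← div_eq_mul_inv, div_le_iff₀ hδ0] at hN
  have h1 : ∃ i j, i ≠ j ∧ δ / 2 ≤ zeroDensity (μ i - μ j).curryRight := by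
    by_contra! h
    have h2 := sum_zeroDensity_ge p f hf hε Finset.univ μ hμ
    rw [hsq, Finset.card_univ, Fintype.card_fin] at h2
    have h3 : ∑ i, ∑ j, zeroDensity (μ i - μ j).curryRight ≤
        ∑ i : Fin N, ∑ j : Fin N, (δ / 2 + if i = j then 1 else 0) := by
      refine Finset.sum_le_sum fun i _ => Finset.sum_le_sum fun j _ => ?_
      split_ifs with hij
      · linarith [zeroDensity_le_one (μ i - μ j).curryRight]
      · linarith [h i j hij]
    simp only [Finset.sum_add_distrib, Finset.sum_const, Finset.card_univ, Fintype.card_fin,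
      Finset.sum_ite_eq, Finset.mem_univ, if_true, nsmul_eq_mul, mul_one] at h3
    nlinarith
  obtain ⟨i, j, hij, hd⟩ := h1
  refine ⟨i, j, hij, hd, ?_⟩
  have h2 := sum_zeroDensity_ge p f hf hε {i, j} μ hμ
  rw [hsq, Finset.card_pair hij, Finset.sum_pair hij, Finset.sum_pair hij, Finset.sum_pair hij]
    at h2
  have h3 := zeroDensity_le_one (μ i - μ i).curryRight
  have h4 := zeroDensity_le_one (μ j - μ i).curryRight
  have h5 := zeroDensity_le_one (μ j - μ j).curryRight
  push_cast at h2
  linarith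

theorem exists_pow_threshold (n : ℕ) : ∃ L₀ : ℕ, ∀ l, L₀ ≤ l → ∀ h ≤ (n + 2) * l ^ (n + 1),
    ((n + 1) * (2 * h + 1) ^ n * (2 * h) + 2) ^ 2 ≤ 2 ^ l := by
  have ht := tendsto_pow_const_div_const_pow_of_one_lt ((n + 1) * (n + 1) * 2) one_lt_two
  have hK : (0 : ℝ) < (((n + 3) * (2 * n + 5) ^ (n + 1)) ^ 2 : ℕ) := by positivity
  obtain ⟨L₀, hL₀⟩ := Filter.eventually_atTop.mp (ht.eventually_lt_const (inv_pos.mpr hK))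
  refine ⟨max L₀ 1, fun l hl h hh => ?_⟩
  have h1 := hL₀ l ((le_max_left _ _).trans hl)
  have hl1 : 1 ≤ l := (le_max_right _ _).trans hl
  have hpow : 1 ≤ l ^ (n + 1) := Nat.one_le_pow _ _ hl1
  have h2 : 2 * h + 1 ≤ (2 * n + 5) * l ^ (n + 1) := by nlinarith
  have h3 : (n + 1) * (2 * h + 1) ^ n * (2 * h) + 2 ≤ (n + 3) * (2 * h + 1) ^ (n + 1) := by
    have h4 : 1 ≤ (2 * h + 1) ^ (n + 1) := Nat.one_le_pow _ _ (by omega)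
    have h5 : (n + 1) * (2 * h + 1) ^ n * (2 * h) ≤ (n + 1) * (2 * h + 1) ^ (n + 1) := by
      rw [pow_succ, mul_assoc]
      gcongr
      omega
    nlinarith
  have h6 : ((n + 1) * (2 * h + 1) ^ n * (2 * h) + 2) ^ 2 ≤
      ((n + 3) * (2 * n + 5) ^ (n + 1)) ^ 2 * l ^ ((n + 1) * (n + 1) * 2) := by
    calc _ ≤ ((n + 3) * ((2 * n + 5) * l ^ (n + 1)) ^ (n + 1)) ^ 2 := by
          refine Nat.pow_le_pow_left (h3.trans ?_) 2
          gcongr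
      _ = _ := by
          rw [mul_pow (2 * n + 5), ← mul_assoc, mul_pow _ ((l ^ (n + 1)) ^ (n + 1)), ← pow_mul,
            ← pow_mul, mul_assoc (n + 1)]
  refine h6.trans ?_
  have h2l : (0 : ℝ) < 2 ^ l := by positivity
  rw [div_lt_iff₀ h2l, inv_mul_eq_div, lt_div_iff₀ hK] at h1
  have h7 : l ^ ((n + 1) * (n + 1) * 2) * ((n + 3) * (2 * n + 5) ^ (n + 1)) ^ 2 < 2 ^ l := by
    exact_mod_cast h1
  rw [mul_comm]
  exact h7.le

theorem exists_prank_of_zeroDensity (n : ℕ) : ∃ K : ℕ, ∀ (p : ℕ) [Fact p.Prime]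
    (G : Fin (n + 1) → Type) [∀ i, AddCommGroup (G i)] [∀ i, Module (ZMod p) (G i)]
    [∀ i, Fintype (G i)] (α : MultilinearMap (ZMod p) G (ZMod p)) (r : ℕ),
    1 ≤ zeroDensity α.curryRight * (p : ℝ) ^ r →
    ∃ m ≤ K * (r + 1) ^ (n + 2), HasPrankDecomp p G α m := by
  obtain ⟨L₀, hL₀⟩ := exists_pow_threshold n
  refine ⟨n * (2 * (n + 2)) * 2 ^ n * (L₀ + 1) ^ (n + 2), fun p _ G _ _ _ α r hr => ?_⟩
  set l := r + (L₀ + 1) with hl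
  have hp2 : 2 ≤ p := (Fact.out : p.Prime).two_le
  have hpow : 1 ≤ l ^ (n + 1) := Nat.one_le_pow _ _ (by omega)
  have hh : r * l ^ n + n + 1 ≤ (n + 2) * l ^ (n + 1) := by
    have : r * l ^ n ≤ l ^ (n + 1) := by
      rw [pow_succ']
      exact Nat.mul_le_mul_right _ (by omega)
    nlinarith
  obtain ⟨m, hm, hdec⟩ := hasPrankDecomp_of_dense_zeros p α (r := r) (l := l)
    (h := r * l ^ n + n + 1) (by omega) le_rfl
    ((hL₀ l (by omega) _ hh).trans (Nat.pow_le_pow_left hp2 l)) (by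
      have hc : (0 : ℝ) < Nat.card (∀ i : Fin n, G i.castSucc) := Nat.cast_pos.mpr Nat.card_pos
      rw [zeroDensity_eq, div_mul_eq_mul_div, one_le_div hc] at hr
      have hr' : Nat.card (∀ i : Fin n, G i.castSucc) ≤
          Nat.card {x : ∀ i : Fin n, G i.castSucc // α.curryRight x = 0} * p ^ r := by
        exact_mod_cast hr
      refine hr'.trans (Nat.mul_le_mul_right _ (Nat.card_le_card_of_injective
        (fun x => ⟨x.1, fun y => LinearMap.congr_fun x.2 y⟩) fun x y hxy => ?_))
      exact Subtype.ext (Subtype.mk.inj hxy))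
  refine ⟨m, hm.trans ?_, hdec⟩
  calc n * (2 * (r * l ^ n + n + 1)) * l * 2 ^ n
      ≤ n * (2 * ((n + 2) * l ^ (n + 1))) * l * 2 ^ n := by gcongr
    _ = n * (2 * (n + 2)) * 2 ^ n * l ^ (n + 2) := by ring
    _ ≤ n * (2 * (n + 2)) * 2 ^ n * ((L₀ + 1) * (r + 1)) ^ (n + 2) := by
        gcongr
        rw [hl]
        nlinarith
    _ = _ := by rw [mul_pow, ← mul_assoc]

/-- If a nonzero form is biased then the bias parameter is bounded away from one. -/
theorem exponent_lower_bound (n : ℕ) {p : ℕ} (hp : p.Prime) {t d : ℝ} (ht : 0 ≤ t)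
    (hd : d ≤ 1 - (1 - 1 / (p : ℝ)) ^ n) (h1 : (p : ℝ) ^ (-t) / 2 ≤ d)
    (h2 : 4 * (p : ℝ) ^ (-t) - 3 ≤ d) :
    1 / (2 ^ (n + 2) * (4 * n ^ 2 + 1)) ≤ t := by
  have hp2 : (2 : ℝ) ≤ p := by exact_mod_cast hp.two_le
  have hp0 : (0 : ℝ) < p := by linarith
  have hpow : (4 : ℝ) ≤ 2 ^ (n + 2) := by
    rw [pow_add]
    have := one_le_pow₀ (M₀ := ℝ) (one_le_two) (n := n)
    linarith
  by_cases hc : 4 * (n : ℝ) ^ 2 < p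
  · have h3 : 1 / 2 ≤ t := by
      by_contra! h
      have hb := one_add_mul_le_pow (a := -(1 / (p : ℝ))) (by
        have : 1 / (p : ℝ) ≤ 1 := by rw [div_le_one hp0]; linarith
        linarith) n
      rw [← sub_eq_add_neg] at hb
      have h4 : (p : ℝ) ^ (-t) * p ≤ 2 * n := by
        have : (p : ℝ) ^ (-t) / 2 ≤ n * (1 / p) := by linarith
        rw [mul_one_div, div_le_div_iff₀ two_pos hp0] at this
        linarith
      have h5 : (p : ℝ) ^ (1 / 2 : ℝ) ≤ (p : ℝ) ^ (-t) * p := by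
        rw [← Real.rpow_add_one hp0.ne']
        exact Real.rpow_le_rpow_of_exponent_le (by linarith) (by linarith)
      have h6 : (p : ℝ) ≤ (2 * n) ^ 2 := by
        calc (p : ℝ) = ((p : ℝ) ^ (1 / 2 : ℝ)) ^ 2 := by
              rw [← Real.rpow_natCast, ← Real.rpow_mul hp0.le]
              norm_num
          _ ≤ _ := pow_le_pow_left₀ (by positivity) (h5.trans h4) 2
      nlinarith
    refine le_trans ?_ h3
    rw [div_le_div_iff₀ (by positivity) two_pos]
    nlinarith [sq_nonneg (n : ℝ)]
  · have hn : (p : ℝ) ≤ 4 * n ^ 2 + 1 := by linarith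
    have h3 : (1 / 2 : ℝ) ^ n ≤ (1 - 1 / (p : ℝ)) ^ n := by
      refine pow_le_pow_left₀ (by norm_num) ?_ n
      have : 1 / (p : ℝ) ≤ 1 / 2 := one_div_le_one_div_of_le two_pos hp2
      linarith
    have h4 : (p : ℝ) ^ (-t) ≤ 1 - 1 / 2 ^ (n + 2) := by
      have : (1 / 2 : ℝ) ^ n = 4 * (1 / 2 ^ (n + 2)) := by
        rw [pow_add, one_div_pow]
        field_simp
        norm_num
      linarith
    have h5 : 1 - t * p ≤ (p : ℝ) ^ (-t) := by
      have h6 := Real.add_one_le_exp (Real.log p * -t)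
      rw [← Real.rpow_def_of_pos hp0] at h6
      have h7 := Real.log_le_sub_one_of_pos hp0
      nlinarith
    rw [← div_div, div_le_iff₀ (by positivity)]
    calc 1 / 2 ^ (n + 2) ≤ t * p := by linarith
      _ ≤ _ := mul_le_mul_of_nonneg_left hn ht

/-- Theorem 16, many spectrum elements give two forms whose difference
has small partition rank: among any `n ≥ 20 ε^{-2^{k+1}}` elements of the `ε`-large
multilinear spectrum of a `1`-bounded function `f`, some two differ by a form of partition
rank at most `C_k (log_p ε⁻¹)^{D_k}`. -/
theorem spectrum_pair_small_partition_rank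
    (k : ℕ) (hk : 0 < k) :
    ∃ C D : ℝ, 0 < C ∧ 0 < D ∧
      ∀ (p : ℕ), p.Prime →
      ∀ (G : Fin k → Type) [∀ i, AddCommGroup (G i)] [∀ i, Module (ZMod p) (G i)]
        [∀ i, Fintype (G i)] (f : (∀ i, G i) → ℂ),
        (∀ x, ‖f x‖ ≤ 1) →
        ∀ (ε : ℝ), 0 < ε →
        ∀ (n : ℕ), (20 : ℝ) * (ε ^ 2 ^ (k + 1))⁻¹ ≤ (n : ℝ) →
        ∀ (μ : Fin n → MultilinearMap (ZMod p) G (ZMod p)),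
          (∀ i, MemMLS p ε f (μ i)) →
          ∃ i j : Fin n, i ≠ j ∧
            ∃ m : ℕ, (m : ℝ) ≤ C * Real.logb p ε⁻¹ ^ D ∧
              HasPrankDecomp p G (μ i - μ j) m := by
  obtain ⟨n, rfl⟩ : ∃ n, k = n + 1 := ⟨k - 1, by omega⟩
  obtain ⟨K, hK⟩ := exists_prank_of_zeroDensity n
  set A : ℝ := 2 ^ (n + 2) with hA
  set c : ℝ := 1 / (2 ^ (n + 2) * (4 * n ^ 2 + 1)) with hc
  have hA0 : 0 < A := by positivity
  have hc0 : 0 < c := by positivity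
  refine ⟨K * (A * (1 + 3 / c)) ^ (n + 2) + 1, (n + 2 : ℕ), by positivity, by positivity, ?_⟩
  intro p hp G _ _ _ f hf ε hε N hN μ hμ
  have : Fact p.Prime := ⟨hp⟩
  have : NeZero p := ⟨hp.ne_zero⟩
  obtain ⟨i, j, hij, hd1, hd2⟩ := exists_pair_biased p f hf hε hN μ hμ
  refine ⟨i, j, hij, ?_⟩
  have hp2 : (2 : ℝ) ≤ p := by exact_mod_cast hp.two_le
  have hp0 : (0 : ℝ) < p := by linarith
  have hp1 : (1 : ℝ) < p := by linarith
  set t : ℝ := Real.logb p ε⁻¹ with ht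
  have hδ : ε ^ 2 ^ (n + 2) = (p : ℝ) ^ (-(A * t)) := by
    have h1 : (p : ℝ) ^ t = ε⁻¹ := Real.rpow_logb hp0 hp1.ne' (inv_pos.mpr hε)
    rw [Real.rpow_neg hp0.le, mul_comm, Real.rpow_mul hp0.le, h1, hA,
      show (2 : ℝ) ^ (n + 2) = ((2 ^ (n + 2) : ℕ) : ℝ) by push_cast; rfl, Real.rpow_natCast,
      inv_pow, inv_inv]
  have ht0 : 0 ≤ t := by
    refine Real.logb_nonneg hp1 ((one_le_inv₀ hε).mpr ?_)
    have := zeroDensity_le_one (μ i - μ j).curryRight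
    exact (pow_le_one_iff_of_nonneg hε.le (pow_ne_zero (n + 2) two_ne_zero)).mp (by linarith)
  by_cases hα : μ i - μ j = 0
  · refine ⟨0, ?_, hα ▸ hasPrankDecomp_zero p G⟩
    rw [Nat.cast_zero]
    exact mul_nonneg (by positivity) (Real.rpow_nonneg ht0 _)
  rw [hδ] at hd1 hd2
  have hct : c ≤ A * t := exponent_lower_bound n hp (by positivity)
    (zeroDensity_curryRight_le p _ hα) hd1 hd2
  obtain ⟨m, hm, hdec⟩ := hK p G (μ i - μ j) (⌈A * t⌉₊ + 1) (by
    have h1 : (p : ℝ) ^ (A * t) * 2 ≤ (p : ℝ) ^ (⌈A * t⌉₊ + 1) := by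
      rw [pow_succ, ← Real.rpow_natCast]
      gcongr
      · exact hp1.le
      · exact Nat.le_ceil _
    rw [Real.rpow_neg hp0.le] at hd1
    calc (1 : ℝ) = ((p : ℝ) ^ (A * t))⁻¹ / 2 * ((p : ℝ) ^ (A * t) * 2) := by field_simp
      _ ≤ _ := mul_le_mul hd1 h1 (by positivity) (le_trans (by positivity) hd1))
  refine ⟨m, ?_, hdec⟩
  have h3 : 3 ≤ A * t * (3 / c) := by
    rw [← mul_div_assoc, le_div_iff₀ hc0]
    linarith
  have h4 : ((⌈A * t⌉₊ + 1 + 1 : ℕ) : ℝ) ≤ A * (1 + 3 / c) * t := by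
    have := (Nat.ceil_lt_add_one (a := A * t) (by positivity)).le
    push_cast
    nlinarith
  rw [Real.rpow_natCast]
  calc (m : ℝ) ≤ K * ((⌈A * t⌉₊ + 1 + 1 : ℕ) : ℝ) ^ (n + 2) := by exact_mod_cast hm
    _ ≤ K * (A * (1 + 3 / c) * t) ^ (n + 2) := by gcongr
    _ = K * (A * (1 + 3 / c)) ^ (n + 2) * t ^ (n + 2) := by rw [mul_pow, mul_assoc]
    _ ≤ _ := by
      gcongr
      linarith

end DGU
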